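/- arXiv:2603.09475 — 4 statements merged into one kernel-verified Lean document; each statement's English description precedes it below -/
import Mathlib

section
/- Theorem 1(a): For every finite simple graph G, the following are equivalent: (i) G belongs to the class C_S (for every T ⊆ V satisfying condition S, G admits an acyclic T-odd orientation); (ii) G belongs to the class C_S̄ (for every T ⊆ V satisfying condition S̄, G admits an acyclic T-odd orientation); (iii) G has at most 2 vertices and no edges. -/
open SimpleGraph

section Defs

variable {V : Type*}

/-- An orientation of a simple graph: each edge gets exactly one direction. -/
structure GraphOrientation {V : Type*} (G : SimpleGraph V) where
  dir : V → V → Prop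
  dir_adj : ∀ u v, dir u v → G.Adj u v
  dir_choice : ∀ u v, G.Adj u v → (dir u v ↔ ¬ dir v u)

/-- An orientation is acyclic if there is no directed cycle, i.e. the transitive
closure of the arc relation is irreflexive. -/
def GraphOrientation.Acyclic {G : SimpleGraph V} (o : GraphOrientation G) : Prop :=
  Irreflexive (Relation.TransGen o.dir)

/-- In-degree of a vertex in an orientation. -/
noncomputable def GraphOrientation.indeg {G : SimpleGraph V} (o : GraphOrientation G)
    (v : V) : ℕ :=
  Set.ncard {u | o.dir u v}

/-- An orientation is `T`-odd if a vertex has odd in-degree iff it belongs to `T`. -/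
def GraphOrientation.IsTOdd {G : SimpleGraph V} (o : GraphOrientation G) (T : Set V) : Prop :=
  ∀ v, Odd (o.indeg v) ↔ v ∈ T

/-- `G` admits an acyclic `T`-odd orientation. -/
def HasAcyclicTOddOrientation (G : SimpleGraph V) (T : Set V) : Prop :=
  ∃ o : GraphOrientation G, o.Acyclic ∧ o.IsTOdd T

/-- Degree of a vertex. -/
noncomputable def vdeg (G : SimpleGraph V) (v : V) : ℕ := (G.neighborSet v).ncard

/-- Potential sources: `V \ T`. -/
def sourceSet (T : Set V) : Set V := Tᶜ

/-- Potential sinks. -/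
def sinkSet (G : SimpleGraph V) (T : Set V) : Set V :=
  {v | (v ∈ T ∧ Odd (vdeg G v)) ∨ (v ∉ T ∧ Even (vdeg G v))}

/-- Parity condition `𝒫`: `|E| + |T|` is even. -/
def CondP (G : SimpleGraph V) (T : Set V) : Prop :=
  Even (G.edgeSet.ncard + T.ncard)

/-- Source condition `𝒮`. -/
def CondS (G : SimpleGraph V) (T : Set V) : Prop :=
  (sourceSet T).Nonempty ∧
    ((sourceSet T).ncard = 1 → Nat.card V = 1 ∨ sourceSet T ≠ sinkSet G T)

/-- Sink condition `𝒮̄`. -/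
def CondSbar (G : SimpleGraph V) (T : Set V) : Prop :=
  (sinkSet G T).Nonempty ∧
    ((sinkSet G T).ncard = 1 → Nat.card V = 1 ∨ sinkSet G T ≠ sourceSet T)

/-- Membership in the class `C_P`. -/
def MemCP (G : SimpleGraph V) : Prop :=
  ∀ T : Set V, CondP G T → HasAcyclicTOddOrientation G T

/-- Membership in the class `C_{P,S}`. -/
def MemCPS (G : SimpleGraph V) : Prop :=
  ∀ T : Set V, CondP G T → CondS G T → HasAcyclicTOddOrientation G T

/-- Membership in the class `C_{P,S̄}`. -/
def MemCPSbar (G : SimpleGraph V) : Prop :=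
  ∀ T : Set V, CondP G T → CondSbar G T → HasAcyclicTOddOrientation G T

/-- Membership in the class `C_{P,S,S̄}`. -/
def MemCPSSbar (G : SimpleGraph V) : Prop :=
  ∀ T : Set V, CondP G T → CondS G T → CondSbar G T → HasAcyclicTOddOrientation G T

/-- A graph is Eulerian if it is connected and every vertex has even degree. -/
def IsEulerianGraph (G : SimpleGraph V) : Prop :=
  G.Connected ∧ ∀ v : V, Even (vdeg G v)

end Defs

namespace GraphOrientation

variable {V : Type*} {G : SimpleGraph V}

/-- The orientation with every arc reversed. -/
def reverse (o : GraphOrientation G) : GraphOrientation G where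
  dir u v := o.dir v u
  dir_adj u v h := (o.dir_adj v u h).symm
  dir_choice u v h := o.dir_choice v u h.symm

theorem Acyclic.reverse {o : GraphOrientation G} (h : o.Acyclic) : o.reverse.Acyclic :=
  fun v hv => h v (Relation.transGen_swap.mp hv)

theorem indeg_add_indeg_reverse [Finite V] (o : GraphOrientation G) (v : V) :
    o.indeg v + o.reverse.indeg v = vdeg G v := by
  have hdisj : Disjoint {u | o.dir u v} {u | o.dir v u} :=
    Set.disjoint_left.mpr fun u hu hv => (o.dir_choice u v (o.dir_adj u v hu)).mp hu hv
  have hunion : {u | o.dir u v} ∪ {u | o.dir v u} = G.neighborSet v := by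
    ext u
    refine ⟨?_, fun h => ?_⟩
    · rintro (h | h)
      · exact (o.dir_adj u v h).symm
      · exact o.dir_adj v u h
    · by_cases hd : o.dir v u
      · exact Or.inr hd
      · exact Or.inl ((o.dir_choice u v h.symm).mpr hd)
  rw [vdeg, ← hunion, Set.ncard_union_eq hdisj]
  rfl

theorem sum_indeg_reverse [Fintype V] (o : GraphOrientation G) :
    ∑ v, o.reverse.indeg v = ∑ v, o.indeg v := by
  classical
  have key (p : GraphOrientation G) (v : V) : p.indeg v = ∑ u, if p.dir u v then 1 else 0 := by
    rw [indeg, Set.ncard_eq_toFinset_card', Finset.sum_boole]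
    simp
  simp only [key]
  exact Finset.sum_comm

/-- The sum of the in-degrees does not depend on the orientation. -/
theorem sum_indeg_eq [Fintype V] (o p : GraphOrientation G) :
    ∑ v, o.indeg v = ∑ v, p.indeg v := by
  have key (q : GraphOrientation G) : 2 * ∑ v, q.indeg v = ∑ v, vdeg G v := by
    simp only [← q.indeg_add_indeg_reverse, Finset.sum_add_distrib, q.sum_indeg_reverse, two_mul]
  have ho := key o
  have hp := key p
  omega

end GraphOrientation

section

variable {V : Type*}

theorem mem_sinkSet_iff {G : SimpleGraph V} {T : Set V} {v : V} :
    v ∈ sinkSet G T ↔ (v ∈ T ↔ Odd (vdeg G v)) := by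
  simp only [sinkSet, Set.mem_ofPred_eq, ← Nat.not_odd_iff_even]
  tauto

theorem sourceSet_compl_sinkSet (G : SimpleGraph V) (T : Set V) :
    sourceSet (sinkSet G T)ᶜ = sinkSet G T :=
  compl_compl _

theorem sinkSet_compl_sinkSet (G : SimpleGraph V) (T : Set V) :
    sinkSet G (sinkSet G T)ᶜ = sourceSet T := by
  ext v
  simp only [mem_sinkSet_iff, sourceSet, Set.mem_compl_iff]
  tauto

theorem condS_compl_sinkSet_iff {G : SimpleGraph V} {T : Set V} :
    CondS G (sinkSet G T)ᶜ ↔ CondSbar G T := by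
  rw [CondS, CondSbar, sourceSet_compl_sinkSet, sinkSet_compl_sinkSet]

theorem condSbar_compl_sinkSet_iff {G : SimpleGraph V} {T : Set V} :
    CondSbar G (sinkSet G T)ᶜ ↔ CondS G T := by
  rw [CondS, CondSbar, sourceSet_compl_sinkSet, sinkSet_compl_sinkSet]

/-- Reversing all arcs exchanges the potential sources with the potential sinks. -/
theorem HasAcyclicTOddOrientation.compl_sinkSet [Finite V] {G : SimpleGraph V} {T : Set V}
    (h : HasAcyclicTOddOrientation G T) : HasAcyclicTOddOrientation G (sinkSet G T)ᶜ := by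
  obtain ⟨o, hacyc, hodd⟩ := h
  refine ⟨o.reverse, hacyc.reverse, fun v => ?_⟩
  rw [Set.mem_compl_iff, mem_sinkSet_iff, ← hodd v, ← o.indeg_add_indeg_reverse v, Nat.odd_add,
    ← Nat.not_odd_iff_even]
  tauto

theorem compl_sinkSet_compl_sinkSet (G : SimpleGraph V) (T : Set V) :
    (sinkSet G (sinkSet G T)ᶜ)ᶜ = T := by
  rw [sinkSet_compl_sinkSet, sourceSet, compl_compl]

theorem forall_condSbar_iff_forall_condS [Finite V] (G : SimpleGraph V) :
    (∀ T : Set V, CondSbar G T → HasAcyclicTOddOrientation G T) ↔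
      ∀ T : Set V, CondS G T → HasAcyclicTOddOrientation G T := by
  constructor <;> intro h T hT <;> rw [← compl_sinkSet_compl_sinkSet G T]
  · exact (h _ (condSbar_compl_sinkSet_iff.mpr hT)).compl_sinkSet
  · exact (h _ (condS_compl_sinkSet_iff.mpr hT)).compl_sinkSet

theorem condS_of_one_lt_ncard_compl {G : SimpleGraph V} {T : Set V} (h : 1 < Tᶜ.ncard) :
    CondS G T :=
  ⟨Set.nonempty_of_ncard_ne_zero (Nat.ne_zero_of_lt h), fun h1 => absurd h1 h.ne'⟩

theorem card_le_two_of_forall_condS [Fintype V] {G : SimpleGraph V}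
    (h : ∀ T : Set V, CondS G T → HasAcyclicTOddOrientation G T) : Fintype.card V ≤ 2 := by
  classical
  by_contra! hcard
  obtain ⟨a⟩ : Nonempty V := Fintype.card_pos_iff.mp (by omega)
  have hV : Nat.card V = Fintype.card V := Nat.card_eq_fintype_card
  obtain ⟨o, -, ho⟩ := h ∅ <| condS_of_one_lt_ncard_compl <| by
    rw [Set.compl_empty, Set.ncard_univ]
    omega
  obtain ⟨p, -, hp⟩ := h {a} <| condS_of_one_lt_ncard_compl <| by
    rw [Set.ncard_compl, Set.ncard_singleton]
    omega
  have heven : Even (∑ v, o.indeg v) :=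
    Finset.even_sum _ fun v _ => Nat.not_odd_iff_even.mp fun hv => (ho v).mp hv
  have hodd : Odd (∑ v, p.indeg v) := by
    rw [Finset.odd_sum_iff_odd_card_odd,
      show Finset.univ.filter (fun v => Odd (p.indeg v)) = {a} by ext v; simp [hp v]]
    simp
  rw [o.sum_indeg_eq p] at heven
  exact Nat.not_even_iff_odd.mpr hodd heven

theorem not_isTOdd_empty_of_dir [Fintype V] {G : SimpleGraph V} (hcard : Fintype.card V ≤ 2)
    (o : GraphOrientation G) {u v : V} (huv : o.dir u v) : ¬ o.IsTOdd ∅ := by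
  classical
  intro h
  have hset : {w | o.dir w v} = {u} := by
    refine Set.eq_singleton_iff_unique_mem.mpr ⟨huv, fun w hw => ?_⟩
    by_contra hwu
    have hthree : ({w, u, v} : Finset V).card = 3 :=
      Finset.card_eq_three.mpr
        ⟨w, u, v, hwu, (o.dir_adj w v hw).ne, (o.dir_adj u v huv).ne, rfl⟩
    have := Finset.card_le_univ ({w, u, v} : Finset V)
    omega
  refine (h v).mp ?_
  rw [GraphOrientation.indeg, hset, Set.ncard_singleton]
  exact odd_one

theorem eq_bot_of_forall_condS [Fintype V] {G : SimpleGraph V}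
    (h : ∀ T : Set V, CondS G T → HasAcyclicTOddOrientation G T) : G = ⊥ := by
  have hcard := card_le_two_of_forall_condS h
  refine SimpleGraph.eq_bot_iff_forall_not_adj.mpr fun u v huv => ?_
  obtain ⟨o, -, ho⟩ := h ∅ <| condS_of_one_lt_ncard_compl <| by
    rw [Set.compl_empty, Set.ncard_univ, Nat.card_eq_fintype_card]
    exact Fintype.one_lt_card_iff.mpr ⟨u, v, huv.ne⟩
  by_cases hd : o.dir v u
  · exact not_isTOdd_empty_of_dir hcard o hd ho
  · exact not_isTOdd_empty_of_dir hcard o ((o.dir_choice u v huv).mpr hd) ho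

theorem hasAcyclicTOddOrientation_bot_empty :
    HasAcyclicTOddOrientation (⊥ : SimpleGraph V) ∅ := by
  refine ⟨⟨fun _ _ => False, fun _ _ h => h.elim, fun _ _ h => h.elim⟩, fun v hv => ?_,
    fun v => ?_⟩
  · obtain ⟨_, _, h⟩ := Relation.TransGen.tail'_iff.mp hv
    exact h
  · simp [GraphOrientation.indeg]

theorem sinkSet_bot (T : Set V) : sinkSet ⊥ T = sourceSet T := by
  ext v
  simp [mem_sinkSet_iff, sourceSet, vdeg, SimpleGraph.neighborSet]

theorem eq_empty_of_condS_bot [Fintype V] (hcard : Fintype.card V ≤ 2) {T : Set V}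
    (h : CondS ⊥ T) : T = ∅ := by
  obtain ⟨hne, hone⟩ := h
  rw [sinkSet_bot] at hone
  have hpos := hne.ncard_pos
  have hadd : T.ncard + (sourceSet T).ncard = Nat.card V := Set.ncard_add_ncard_compl T
  rw [Nat.card_eq_fintype_card] at hadd hone
  rw [← Set.ncard_eq_zero]
  by_cases h1 : (sourceSet T).ncard = 1
  · have := (hone h1).resolve_right fun h => h rfl
    omega
  · omega

theorem forall_condS_iff [Fintype V] (G : SimpleGraph V) :
    (∀ T : Set V, CondS G T → HasAcyclicTOddOrientation G T) ↔
      (Fintype.card V ≤ 2 ∧ G.edgeSet = ∅) := by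
  rw [SimpleGraph.edgeSet_eq_empty]
  constructor
  · exact fun h => ⟨card_le_two_of_forall_condS h, eq_bot_of_forall_condS h⟩
  · rintro ⟨hcard, rfl⟩ T hT
    rw [eq_empty_of_condS_bot hcard hT]
    exact hasAcyclicTOddOrientation_bot_empty

end

/-- Theorem 1(a): `C_S = C_S̄ = ` {graphs with at most two vertices and no edges}. -/
theorem thm_a {V : Type*} [Fintype V] [Nonempty V] (G : SimpleGraph V) :
    ((∀ T : Set V, CondS G T → HasAcyclicTOddOrientation G T) ↔
      (Fintype.card V ≤ 2 ∧ G.edgeSet = ∅)) ∧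
    ((∀ T : Set V, CondSbar G T → HasAcyclicTOddOrientation G T) ↔
      (Fintype.card V ≤ 2 ∧ G.edgeSet = ∅)) :=
  ⟨forall_condS_iff G, (forall_condSbar_iff_forall_condS G).trans (forall_condS_iff G)⟩
end

section
/- Theorem 1(c): For every finite simple graph G, G belongs to the class C_P if and only if either G has exactly one vertex, or all of the following hold: G belongs to the class C_{P,S,S̄}, G is connected, G has at least one vertex of odd degree (i.e., G is not Eulerian), and |V| + |E| is odd. -/
open SimpleGraph

namespace GraphOrientation

variable {V : Type*} {G : SimpleGraph V}

/-- In an acyclic orientation of a finite graph, every nonempty set of vertices that is closed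
under in-neighbours contains a source. -/
theorem Acyclic.exists_source_mem [Finite V] {o : GraphOrientation G} (ho : o.Acyclic)
    {K : Set V} (hne : K.Nonempty) (hK : ∀ u v, o.dir u v → v ∈ K → u ∈ K) :
    ∃ v ∈ K, ∀ u, ¬ o.dir u v := by
  have : Std.Irrefl (Relation.TransGen o.dir) := ⟨ho⟩
  have hwf : WellFounded (Relation.TransGen o.dir) := Finite.wellFounded_of_trans_of_irrefl _
  obtain ⟨v, hv, hmin⟩ := hwf.has_min K hne
  exact ⟨v, hv, fun u huv => hmin u (hK u v huv hv) (.single huv)⟩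

/-- An acyclic orientation of a nonempty finite graph has a sink. -/
theorem Acyclic.exists_sink [Finite V] [Nonempty V] {o : GraphOrientation G} (ho : o.Acyclic) :
    ∃ v, ∀ u, ¬ o.dir v u := by
  have : Std.Irrefl (Function.swap (Relation.TransGen o.dir)) := ⟨ho⟩
  have : IsTrans V (Function.swap (Relation.TransGen o.dir)) := ⟨fun _ _ _ h h' => h'.trans h⟩
  have hwf : WellFounded (Function.swap (Relation.TransGen o.dir)) :=
    Finite.wellFounded_of_trans_of_irrefl _
  obtain ⟨v, -, hmin⟩ := hwf.has_min Set.univ Set.univ_nonempty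
  exact ⟨v, fun u huv => hmin u trivial (.single huv)⟩

theorem indeg_eq_zero_of_source {o : GraphOrientation G} {v : V} (hv : ∀ u, ¬ o.dir u v) :
    o.indeg v = 0 := by
  simp [indeg, hv]

theorem indeg_eq_vdeg_of_sink {o : GraphOrientation G} {v : V} (hv : ∀ u, ¬ o.dir v u) :
    o.indeg v = vdeg G v := by
  unfold indeg vdeg
  congr 1
  ext u
  exact ⟨fun h => (o.dir_adj u v h).symm, fun h => (o.dir_choice u v h.symm).2 (hv u)⟩

theorem IsTOdd.notMem_of_source {o : GraphOrientation G} {T : Set V} (hT : o.IsTOdd T) {v : V}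
    (hv : ∀ u, ¬ o.dir u v) : v ∉ T := by
  simp [← hT v, indeg_eq_zero_of_source hv]

end GraphOrientation

section

variable {V : Type*} {G : SimpleGraph V}

/-- If `T` contains a nonempty set closed under adjacency, there is no acyclic `T`-odd
orientation. -/
theorem not_hasAcyclicTOddOrientation_of_subset [Finite V] {K T : Set V} (hne : K.Nonempty)
    (hK : ∀ u v, G.Adj u v → v ∈ K → u ∈ K) (hKT : K ⊆ T) :
    ¬ HasAcyclicTOddOrientation G T := by
  rintro ⟨o, ho, hT⟩
  obtain ⟨v, hv, hsrc⟩ := ho.exists_source_mem hne fun u v h => hK u v (o.dir_adj u v h)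
  exact hT.notMem_of_source hsrc (hKT hv)

/-- The number of vertices of even degree has the same parity as the number of vertices. -/
theorem even_card_add_ncard_even_vdeg [Fintype V] (G : SimpleGraph V) :
    Even (Fintype.card V + {v | Even (vdeg G v)}.ncard) := by
  classical
  have hdeg (v : V) : vdeg G v = G.degree v := by
    rw [vdeg, Set.ncard_eq_toFinset_card', ← SimpleGraph.card_neighborFinset_eq_degree]
    rfl
  have hodd : {v | Odd (vdeg G v)}.ncard = (Finset.univ.filter fun v => Odd (G.degree v)).card := by
    rw [← Set.ncard_coe_finset]
    simp [hdeg]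
  have hcompl : {v | Even (vdeg G v)}ᶜ = {v | Odd (vdeg G v)} := by
    ext v
    simp
  have hsum := Set.ncard_add_ncard_compl {v | Even (vdeg G v)}
  have heven := G.even_card_odd_degree_vertices
  rw [hcompl, hodd, Nat.card_eq_fintype_card] at hsum
  grind

theorem even_vdeg_of_sourceSet_eq_sinkSet {T : Set V} (h : sourceSet T = sinkSet G T) (v : V) :
    Even (vdeg G v) := by
  have hv := Set.ext_iff.1 h v
  simp only [sourceSet, sinkSet, Set.mem_compl_iff, Set.mem_ofPred_eq] at hv
  rw [← Nat.not_odd_iff_even] at *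
  tauto

theorem CondP.sourceSet_nonempty [Fintype V] {T : Set V} (hP : CondP G T)
    (hodd : Odd (Fintype.card V + G.edgeSet.ncard)) : (sourceSet T).Nonempty := by
  rw [sourceSet, Set.nonempty_compl]
  rintro rfl
  rw [CondP, Set.ncard_univ, Nat.card_eq_fintype_card] at hP
  grind

theorem CondP.sinkSet_nonempty [Fintype V] {T : Set V} (hP : CondP G T)
    (hodd : Odd (Fintype.card V + G.edgeSet.ncard)) : (sinkSet G T).Nonempty := by
  by_contra hempty
  rw [Set.not_nonempty_iff_eq_empty] at hempty
  have hT : T = {v | Even (vdeg G v)} := by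
    ext v
    have hv := Set.ext_iff.1 hempty v
    simp only [sinkSet, Set.mem_ofPred_eq, Set.mem_empty_iff_false, iff_false,
      ← Nat.not_even_iff_odd] at hv ⊢
    tauto
  have hcard := even_card_add_ncard_even_vdeg G
  rw [CondP, hT] at hP
  grind

theorem memCP_of_card_eq_one [Fintype V] (hV : Fintype.card V = 1) : MemCP G := by
  have : Subsingleton V := Fintype.card_le_one_iff_subsingleton.1 hV.le
  intro T hP
  have hE : G.edgeSet = ∅ := by
    rw [SimpleGraph.edgeSet_eq_empty]
    exact Subsingleton.elim _ _
  have hT : T = ∅ := by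
    have hle : T.ncard ≤ 1 := Set.ncard_le_one_of_subsingleton T
    rw [CondP, hE, Set.ncard_empty, zero_add] at hP
    rw [← Set.ncard_eq_zero]
    grind
  refine ⟨⟨fun _ _ => False, fun _ _ h => h.elim, fun u v h => ?_⟩, fun v hv => ?_, fun v => ?_⟩
  · exact (h.ne (Subsingleton.elim u v)).elim
  · obtain ⟨_, -, h⟩ := Relation.TransGen.tail'_iff.1 hv
    exact h
  · simp [GraphOrientation.indeg, hT]

theorem MemCP.odd_card_add [Fintype V] [Nonempty V] (h : MemCP G) :
    Odd (Fintype.card V + G.edgeSet.ncard) := by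
  by_contra hodd
  refine not_hasAcyclicTOddOrientation_of_subset Set.univ_nonempty (fun _ _ _ _ => trivial)
    subset_rfl (h Set.univ ?_)
  rw [CondP, Set.ncard_univ, Nat.card_eq_fintype_card]
  grind

theorem MemCP.connected [Finite V] [Nonempty V] (h : MemCP G) : G.Connected := by
  rw [SimpleGraph.connected_iff]
  refine ⟨fun a b => ?_, inferInstance⟩
  by_contra hab
  let K : Set V := {u | G.Reachable u a}
  have hK : ∀ u v, G.Adj u v → v ∈ K → u ∈ K := fun u v huv hv => huv.reachable.trans hv
  have hne : K.Nonempty := ⟨a, SimpleGraph.Reachable.refl a⟩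
  have hb : b ∉ K := fun hb => hab hb.symm
  by_cases hP : CondP G K
  · exact not_hasAcyclicTOddOrientation_of_subset hne hK subset_rfl (h K hP)
  · refine not_hasAcyclicTOddOrientation_of_subset hne hK (Set.subset_insert b K) (h _ ?_)
    rw [CondP] at hP ⊢
    rw [Set.ncard_insert_of_notMem hb]
    grind

theorem MemCP.exists_odd_vdeg [Fintype V] [Nonempty V] (h : MemCP G)
    (hV : Fintype.card V ≠ 1) : ∃ v, Odd (vdeg G v) := by
  by_contra! heven
  simp only [Nat.not_odd_iff_even] at heven
  obtain ⟨v⟩ := ‹Nonempty V›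
  have : Nontrivial V := Fintype.one_lt_card_iff_nontrivial.1 (by
    have := Fintype.card_pos_iff.2 ⟨v⟩
    omega)
  obtain ⟨o, ho, hT⟩ := h {v}ᶜ (by
    have hodd := h.odd_card_add
    have hsum := Set.ncard_add_ncard_compl {v}
    rw [Set.ncard_singleton, Nat.card_eq_fintype_card] at hsum
    rw [CondP]
    grind)
  have hmem {w : V} (hw : w ∉ ({v}ᶜ : Set V)) : w = v := by simpa using hw
  obtain ⟨s, -, hs⟩ := ho.exists_source_mem ⟨v, Set.mem_univ v⟩ fun _ _ _ _ => trivial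
  obtain ⟨t, ht⟩ := ho.exists_sink
  obtain rfl := hmem (hT.notMem_of_source hs)
  have hts : t = s := hmem (by
    rw [← hT t, GraphOrientation.indeg_eq_vdeg_of_sink ht, Nat.not_odd_iff_even]
    exact heven t)
  subst hts
  obtain ⟨u, hu⟩ := h.connected.preconnected.exists_adj_of_nontrivial t
  exact hs u ((o.dir_choice u t hu.symm).2 (ht u))

end

/-- Theorem 1(c): characterization of the class `C_P`. -/
theorem thm_c {V : Type*} [Fintype V] [Nonempty V] (G : SimpleGraph V) :
    MemCP G ↔
      (Fintype.card V = 1 ∨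
        (MemCPSSbar G ∧ G.Connected ∧ (∃ v : V, Odd (vdeg G v)) ∧
          Odd (Fintype.card V + G.edgeSet.ncard))) := by
  refine ⟨fun h => ?_, ?_⟩
  · by_cases hV : Fintype.card V = 1
    · exact Or.inl hV
    · exact Or.inr ⟨fun T hP _ _ => h T hP, h.connected, h.exists_odd_vdeg hV, h.odd_card_add⟩
  · rintro (hV | ⟨hmem, -, ⟨v, hv⟩, hodd⟩)
    · exact memCP_of_card_eq_one hV
    · intro T hP
      have hne : sourceSet T ≠ sinkSet G T := fun heq =>
        Nat.not_even_iff_odd.2 hv (even_vdeg_of_sourceSet_eq_sinkSet heq v)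
      exact hmem T hP ⟨hP.sourceSet_nonempty hodd, fun _ => Or.inr hne⟩
        ⟨hP.sinkSet_nonempty hodd, fun _ => Or.inr hne.symm⟩
end

section
/- Theorem 1(e): For every finite simple graph G, if G belongs to C_{P,S,S̄} but not to C_{P,S}, then either G has exactly 3 vertices and exactly one edge (a single edge together with an isolated vertex), or G is connected, G has at least one vertex of odd degree (i.e., G is not Eulerian), and |V| + |E| is even. -/
open SimpleGraph

/-- In a `T`-odd orientation, the number of edges meeting a union `H` of components has the parity
of `T ∩ H`. -/
theorem GraphOrientation.IsTOdd.even_ncard_add {V : Type*} [Finite V] {G : SimpleGraph V}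
    {o : GraphOrientation G} {T : Set V} (ho : o.IsTOdd T) (H : Set V)
    (hH : ∀ u v, G.Adj u v → (u ∈ H ↔ v ∈ H)) :
    Even ({e ∈ G.edgeSet | ∃ v ∈ e, v ∈ H}.ncard + (T ∩ H).ncard) := by
  classical
  have := Fintype.ofFinite V
  have hbij : {e ∈ G.edgeSet | ∃ v ∈ e, v ∈ H}.ncard =
      {p : V × V | o.dir p.1 p.2 ∧ p.2 ∈ H}.ncard := by
    symm
    apply Set.ncard_congr (fun p _ => s(p.1, p.2))
    · rintro ⟨u, v⟩ ⟨h, hv⟩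
      exact ⟨o.dir_adj _ _ h, v, Sym2.mem_mk_right _ _, hv⟩
    · rintro ⟨u, v⟩ ⟨u', v'⟩ ⟨h, -⟩ ⟨h', -⟩ he
      rcases Sym2.eq_iff.1 he with ⟨rfl, rfl⟩ | ⟨rfl, rfl⟩
      · rfl
      · exact absurd h' ((o.dir_choice _ _ (o.dir_adj _ _ h)).1 h)
    · intro e
      induction e using Sym2.ind with
      | _ u v =>
        rintro ⟨huv, w, hw, hwH⟩
        have huv : G.Adj u v := huv
        have hiff := hH u v huv
        have hmem : u ∈ H ∧ v ∈ H := by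
          rcases Sym2.mem_iff.1 hw with rfl | rfl
          · exact ⟨hwH, hiff.1 hwH⟩
          · exact ⟨hiff.2 hwH, hwH⟩
        by_cases h : o.dir u v
        · exact ⟨(u, v), ⟨h, hmem.2⟩, rfl⟩
        · exact ⟨(v, u), ⟨(o.dir_choice v u huv.symm).2 h, hmem.1⟩, Sym2.eq_swap⟩
  have hsum : {p : V × V | o.dir p.1 p.2 ∧ p.2 ∈ H}.ncard =
      ∑ v with v ∈ H, o.indeg v := by
    have hset : {p : V × V | o.dir p.1 p.2 ∧ p.2 ∈ H} =
        ↑({p : V × V | o.dir p.1 p.2 ∧ p.2 ∈ H} : Finset (V × V)) := by simp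
    rw [hset, Set.ncard_coe_finset,
      Finset.card_eq_sum_card_fiberwise (f := Prod.snd) (t := ({v | v ∈ H} : Finset V))
        (fun p hp => by simp at hp ⊢; exact hp.2)]
    refine Finset.sum_congr rfl fun v hv => ?_
    have hv : v ∈ H := by simpa using hv
    rw [GraphOrientation.indeg, ← Set.ncard_coe_finset]
    refine Set.ncard_congr (fun p _ => p.1) ?_ ?_ ?_
    · rintro ⟨u, w⟩ h
      simp only [Finset.coe_filter, Finset.mem_filter, Finset.mem_univ, true_and,
        Set.mem_ofPred_eq] at h
      obtain ⟨⟨h, -⟩, rfl⟩ := h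
      exact h
    · rintro ⟨u, w⟩ ⟨u', w'⟩ h h' he
      simp only [Finset.coe_filter, Finset.mem_filter, Finset.mem_univ, true_and,
        Set.mem_ofPred_eq] at h h' he
      rw [Prod.mk.injEq]
      exact ⟨he, h.2.trans h'.2.symm⟩
    · intro u hu
      exact ⟨(u, v), by simpa using ⟨hu, hv⟩, rfl⟩
  have hT : (T ∩ H).ncard = Finset.card {v ∈ ({v | v ∈ H} : Finset V) | Odd (o.indeg v)} := by
    rw [← Set.ncard_coe_finset]
    congr 1
    ext v
    simp [ho v, and_comm]
  rw [hbij, hsum, hT, Nat.even_add, ← Nat.not_odd_iff_even, ← Nat.not_odd_iff_even,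
    Finset.odd_sum_iff_odd_card_odd]

/-- If `|V| + |E|` is even, the complement of a pair other than the set of odd-degree vertices
satisfies all three conditions. -/
theorem MemCPSSbar.hasAcyclicTOddOrientation_compl_pair {V : Type*} [Finite V]
    {G : SimpleGraph V} (hG : MemCPSSbar G) (hpar : Even (Nat.card V + G.edgeSet.ncard))
    {x y : V} (hxy : x ≠ y) (hne : {v | Odd (vdeg G v)} ≠ {x, y}) :
    HasAcyclicTOddOrientation G {x, y}ᶜ := by
  have hcard : ({x, y} : Set V).ncard = 2 := Set.ncard_pair hxy
  have hsrc : sourceSet ({x, y}ᶜ : Set V) = {x, y} := compl_compl _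
  refine hG _ ?_ ⟨by simp [hsrc], by simp [hsrc, hcard]⟩ ⟨?_, fun h => .inr fun he => ?_⟩
  · have := Set.ncard_add_ncard_compl ({x, y} : Set V)
    rw [hcard] at this
    unfold CondP
    rw [← this] at hpar
    grind
  · by_contra hempty
    rw [Set.not_nonempty_iff_eq_empty, Set.eq_empty_iff_forall_notMem] at hempty
    refine hne (Set.ext fun v => ?_)
    have := hempty v
    simp only [sinkSet, Set.mem_ofPred_eq, Set.mem_compl_iff, ← Nat.not_odd_iff_even] at this ⊢
    by_cases hv : v ∈ ({x, y} : Set V) <;> simp_all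
  · rw [he, hsrc, hcard] at h
    omega

/-- A disconnected graph in `C_{P,S,S̄}` with `|V| + |E|` even has at most three vertices. -/
theorem MemCPSSbar.card_le_three_of_not_connected {V : Type*} [Fintype V] [Nonempty V]
    {G : SimpleGraph V} (hG : MemCPSSbar G) (hpar : Even (Nat.card V + G.edgeSet.ncard))
    (hconn : ¬ G.Connected) : Fintype.card V ≤ 3 := by
  classical
  by_contra! hcard
  have hpre : ¬ G.Preconnected := fun h => hconn ⟨h⟩
  simp only [Preconnected, not_forall] at hpre
  obtain ⟨s, r, hsr⟩ := hpre
  set H : Set V := {v | G.Reachable s v}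
  have hs : s ∈ H := Reachable.refl s
  have hr : r ∉ H := hsr
  have hH : ∀ u v, G.Adj u v → (u ∈ H ↔ v ∈ H) := fun u v h =>
    ⟨fun hu => hu.trans h.reachable, fun hv => hv.trans h.symm.reachable⟩
  set O : Set V := {v | Odd (vdeg G v)}
  set m := {e ∈ G.edgeSet | ∃ v ∈ e, v ∈ H}.ncard
  have hkey : ∀ x y, x ≠ y → O ≠ {x, y} → Even (m + (H \ {x, y}).ncard) := by
    intro x y hxy hne
    obtain ⟨o, -, ho⟩ := hG.hasAcyclicTOddOrientation_compl_pair hpar hxy hne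
    have := ho.even_ncard_add H hH
    rwa [Set.inter_comm, ← Set.sdiff_eq] at this
  have hmem : ∀ {x y}, O = {x, y} → x ∈ O ∧ y ∈ O ∧ ∀ z ∈ O, z = x ∨ z = y := by
    intro x y h
    simp [h]
  obtain ⟨t, -, ht⟩ := Finset.exists_subset_card_eq (s := (Finset.univ : Finset V)) (n := 4)
    (by rw [Finset.card_univ]; omega)
  obtain ⟨a, b, c, d, hab, hac, had, hbc, hbd, hcd, -⟩ := Finset.card_eq_four.1 ht
  by_cases hm : Even (m + H.ncard)
  · have hcross : ∀ x y, x ∈ H → y ∉ H → x ∈ O ∧ y ∈ O ∧ ∀ z ∈ O, z = x ∨ z = y := by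
      intro x y hx hy
      have hxy : x ≠ y := by rintro rfl; exact hy hx
      refine hmem (by_contra fun hne => ?_)
      have h1 := hkey x y hxy hne
      have h2 : (H \ {x, y}).ncard + 1 = H.ncard := by
        have h3 : H \ {x, y} = H \ {x} := by
          ext z
          simp only [Set.mem_sdiff, Set.mem_insert_iff, Set.mem_singleton_iff]
          grind
        rw [h3]
        exact Set.ncard_sdiff_singleton_add_one hx
      rw [← h2] at hm
      grind
    have hO : ∀ z, z = s ∨ z = r := fun z => (hcross s r hs hr).2.2 z <| by
      by_cases hz : z ∈ H
      exacts [(hcross z r hz hr).1, (hcross s z hs hz).2.1]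
    have h1 := hO a
    have h2 := hO b
    have h3 := hO c
    clear_value H O
    clear hcross hmem hkey hH hO hm m hpar hcard ht
    grind
  · have hsame : ∀ x y, x ≠ y → (x ∈ H ↔ y ∈ H) → x ∈ O ∧ y ∈ O ∧ ∀ z ∈ O, z = x ∨ z = y := by
      intro x y hxy hiff
      refine hmem (by_contra fun hne => ?_)
      have h1 := hkey x y hxy hne
      by_cases hx : x ∈ H
      · have h2 : (H \ {x, y}).ncard + 2 = H.ncard := by
          rw [← Set.ncard_pair hxy]
          exact Set.ncard_sdiff_add_ncard_of_subset (by
            rintro z (rfl | rfl)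
            exacts [hx, hiff.1 hx])
        rw [← h2] at hm
        grind
      · have h2 : H \ {x, y} = H := by
          ext z
          simp only [Set.mem_sdiff, Set.mem_insert_iff, Set.mem_singleton_iff]
          grind
        exact hm (h2 ▸ h1)
    have h1 := hsame a b hab
    have h2 := hsame a c hac
    have h3 := hsame a d had
    have h4 := hsame b c hbc
    have h5 := hsame b d hbd
    have h6 := hsame c d hcd
    clear_value H O
    clear hsame hmem hkey hH hm m hpar hcard ht
    by_cases ha : a ∈ H <;> by_cases hb : b ∈ H <;> by_cases hc : c ∈ H <;>
      by_cases hd : d ∈ H <;> grind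

/-- Theorem 1(e): `C_{P,S,S̄} \ C_{P,S}` is contained in the single-edge-plus-isolated-vertex
graph together with connected non-Eulerian graphs with `|V| + |E|` even. -/
theorem thm_e {V : Type*} [Fintype V] [Nonempty V] (G : SimpleGraph V)
    (h1 : MemCPSSbar G) (h2 : ¬ MemCPS G) :
    (Fintype.card V = 3 ∧ G.edgeSet.ncard = 1) ∨
      (G.Connected ∧ (∃ v : V, Odd (vdeg G v)) ∧
        Even (Fintype.card V + G.edgeSet.ncard)) := by
  classical
  have hdeg : ∀ v, vdeg G v = G.degree v := fun v => by
    rw [vdeg, ← Nat.card_coe_set_eq, Nat.card_eq_fintype_card, card_neighborSet_eq_degree]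
  have hedge : G.edgeSet.ncard = G.edgeFinset.card := by
    rw [← coe_edgeFinset, Set.ncard_coe_finset]
  simp only [MemCPS, not_forall] at h2
  obtain ⟨T, hP, hS, hT⟩ := h2
  have hsink : ∀ v, v ∉ sinkSet G T := by
    by_contra! hne
    refine hT (h1 T hP hS ⟨hne, fun hone => ?_⟩)
    by_contra! h
    exact (hS.2 (h.2 ▸ hone)).elim h.1 (fun h' => h' h.2.symm)
  have hTc : ∀ v, v ∉ T ↔ Odd (vdeg G v) := by
    intro v
    have := hsink v
    simp only [sinkSet, Set.mem_ofPred_eq, ← Nat.not_odd_iff_even] at this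
    tauto
  obtain ⟨w, hw⟩ := hS.1
  have hodd : Odd (vdeg G w) := (hTc w).1 hw
  have hpar : Even (Fintype.card V + G.edgeSet.ncard) := by
    have h3 : Tᶜ.ncard = Finset.card {v | Odd (G.degree v)} := by
      rw [← Set.ncard_coe_finset]
      congr 1
      ext v
      simp [hTc, hdeg]
    have h4 := G.even_card_odd_degree_vertices
    have h5 := Set.ncard_add_ncard_compl T
    rw [Nat.card_eq_fintype_card] at h5
    unfold CondP at hP
    rw [← h5, h3]
    grind
  by_cases hconn : G.Connected
  · exact .inr ⟨hconn, ⟨w, hodd⟩, hpar⟩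
  left
  have hle := h1.card_le_three_of_not_connected (by rwa [Nat.card_eq_fintype_card]) hconn
  have hbound := G.card_edgeFinset_le_card_choose_two
  have hlt : G.edgeFinset.card ≠ (Fintype.card V).choose 2 := by
    intro h
    rw [← card_edgeFinset_top_eq_card_choose_two] at h
    have htop := Finset.eq_of_subset_of_card_le (edgeFinset_mono (le_top : G ≤ ⊤)) h.ge
    rw [edgeFinset_inj] at htop
    exact hconn (htop ▸ connected_top)
  have hm : 0 < G.edgeFinset.card := by
    obtain ⟨u, hu⟩ := (G.degree_pos_iff_exists_adj w).1 (hdeg w ▸ hodd.pos)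
    exact Finset.card_pos.2 ⟨s(w, u), mem_edgeFinset.2 hu⟩
  rw [Nat.choose_two_right] at hbound hlt
  rw [hedge] at hpar ⊢
  rw [Nat.even_iff] at hpar
  have hpos := Fintype.card_pos (α := V)
  generalize G.edgeFinset.card = m at *
  generalize Fintype.card V = n at *
  interval_cases n <;> omega
end

section
/- Theorem 2: Let p ≥ 3 and q ≥ 1, and let G be either the cylinder C_p □ P_q, or (when q ≥ 3) the torus C_p □ C_q. Let T ⊆ V(G) satisfy conditions P, S and S̄. If G is a cylinder C_p □ P_q, or if G is a torus C_p □ C_q with p ≥ 4 and q ≥ 4, then G admits an acyclic T-odd orientation. -/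
open SimpleGraph

/-- The neighbours of `v` lying in `A`. -/
def nbrsIn {V : Type*} (G : SimpleGraph V) (A : Set V) (v : V) : Set V :=
  {w | w ∈ A ∧ G.Adj v w}

/-- `Red G A B`: one can go from `A` to `B` by successively deleting vertices that have an odd
number of neighbours in the current set. -/
inductive Red {V : Type*} (G : SimpleGraph V) : Set V → Set V → Prop
  | refl (A : Set V) : Red G A A
  | step {A B : Set V} {v : V} : v ∈ A → Odd (nbrsIn G A v).ncard → Red G (A \ {v}) B → Red G A B

/-- `A` can be reduced to a single vertex by deleting vertices of odd degree. -/
def Good {V : Type*} (G : SimpleGraph V) (A : Set V) : Prop :=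
  ∃ r, Red G A {r}

/-- There is a ranking of `A` such that each vertex of `A` outside `E` has an odd number of
neighbours of smaller rank if and only if it lies in `T`. -/
def Ranked {V : Type*} (G : SimpleGraph V) (E A T : Set V) : Prop :=
  ∃ r : V → ℕ, Set.InjOn r A ∧
    ∀ v ∈ A, v ∉ E → (Odd {w | w ∈ A ∧ G.Adj v w ∧ r w < r v}.ncard ↔ v ∈ T)

section Abstract

variable {V W : Type*} {G : SimpleGraph V} {H : SimpleGraph W}

theorem Red.trans {A B C : Set V} (h : Red G A B) (h' : Red G B C) : Red G A C := by
  induction h with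
  | refl A => exact h'
  | step hv ho _ ih => exact Red.step hv ho (ih h')

theorem Red.good {A B : Set V} (h : Red G A B) (h' : Good G B) : Good G A :=
  ⟨h'.choose, h.trans h'.choose_spec⟩

theorem Red.preimage (f : V → W) (hf : Function.Injective f) {X Y : Set W} (h : Red H X Y)
    (hX : X ⊆ Set.range f)
    (hadj : ∀ u v, f u ∈ X → f v ∈ X → (G.Adj u v ↔ H.Adj (f u) (f v))) :
    Red G (f ⁻¹' X) (f ⁻¹' Y) := by
  induction h with
  | refl => exact Red.refl _
  | @step A B v hv ho _ ih =>
    obtain ⟨u, rfl⟩ := hX hv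
    refine Red.step (v := u) hv ?_ ?_
    · have : nbrsIn H A (f u) = f '' nbrsIn G (f ⁻¹' A) u := by
        ext w
        constructor
        · rintro ⟨hw, ha⟩
          obtain ⟨x, rfl⟩ := hX hw
          exact ⟨x, ⟨hw, (hadj _ _ hv hw).2 ha⟩, rfl⟩
        · rintro ⟨x, ⟨hx, ha⟩, rfl⟩
          exact ⟨hx, (hadj _ _ hv hx).1 ha⟩
      rwa [this, Set.ncard_image_of_injective _ hf] at ho
    · have h2 : f ⁻¹' A \ {u} = f ⁻¹' (A \ {f u}) := by
        ext x
        simp [hf.eq_iff]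
      rw [h2]
      exact ih (fun x hx => hX hx.1) fun a b ha hb => hadj a b ha.1 hb.1

theorem Red.subset {A B : Set V} (h : Red G A B) : B ⊆ A := by
  induction h with
  | refl => exact subset_rfl
  | step _ _ _ ih => exact ih.trans Set.sdiff_subset

theorem Good.preimage (f : V → W) (hf : Function.Injective f) {X : Set W} (h : Good H X)
    (hX : X ⊆ Set.range f)
    (hadj : ∀ u v, f u ∈ X → f v ∈ X → (G.Adj u v ↔ H.Adj (f u) (f v))) :
    Good G (f ⁻¹' X) := by
  obtain ⟨r, h⟩ := h
  obtain ⟨u, rfl⟩ := hX (h.subset rfl)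
  refine ⟨u, ?_⟩
  have := h.preimage f hf hX hadj
  rwa [← Set.image_singleton, Set.preimage_image_eq _ hf] at this

/-- The orientation of a graph that directs each edge towards the larger rank. -/
def rankOrientation (G : SimpleGraph V) (r : V → ℕ) (hr : Function.Injective r) :
    GraphOrientation G where
  dir u v := G.Adj u v ∧ r u < r v
  dir_adj _ _ h := h.1
  dir_choice u v h := by
    have : r u ≠ r v := fun e => h.ne (hr e)
    simp only [h, h.symm, true_and]
    omega

theorem rankOrientation_acyclic (r : V → ℕ) (hr : Function.Injective r) :
    (rankOrientation G r hr).Acyclic := by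
  have key : ∀ u v, Relation.TransGen (rankOrientation G r hr).dir u v → r u < r v := by
    intro u v h
    induction h with
    | single h => exact h.2
    | tail _ h ih => exact ih.trans h.2
  exact fun v h => lt_irrefl _ (key v v h)

theorem GraphOrientation.sum_indeg [Fintype V] (o : GraphOrientation G) :
    ∑ v, o.indeg v = G.edgeSet.ncard := by
  classical
  have h1 : ∀ v, o.indeg v = (Finset.univ.filter fun u => o.dir u v).card := by
    intro v
    rw [GraphOrientation.indeg, ← Set.ncard_coe_finset]
    simp
  simp only [h1]
  rw [← Finset.card_sigma, ← Set.ncard_coe_finset]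
  refine Set.ncard_congr (fun x _ => s(x.2, x.1)) ?_ ?_ ?_
  · rintro ⟨v, u⟩ h
    exact o.dir_adj _ _ (by simpa using h)
  · rintro ⟨v, u⟩ ⟨v', u'⟩ h h' he
    have h : o.dir u v := by simpa using h
    have h' : o.dir u' v' := by simpa using h'
    simp only [Sym2.eq_iff] at he
    rcases he with ⟨rfl, rfl⟩ | ⟨rfl, rfl⟩
    · rfl
    · exact absurd h' ((o.dir_choice _ _ (o.dir_adj _ _ h)).1 h)
  · intro e
    induction e using Sym2.ind with
    | _ u v =>
      intro h
      by_cases hd : o.dir u v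
      · exact ⟨⟨v, u⟩, by simpa using hd, rfl⟩
      · have := (o.dir_choice v u (G.adj_symm h)).2 hd
        exact ⟨⟨u, v⟩, by simpa using this, Sym2.eq_swap⟩

variable [Finite V]

theorem Ranked.insert_last {E A T : Set V} {v : V} (hv : v ∈ A)
    (ho : Odd (nbrsIn G A v).ncard ↔ v ∈ T) (h : Ranked G E (A \ {v}) T) : Ranked G E A T := by
  classical
  obtain ⟨r, hinj, hr⟩ := h
  obtain ⟨M, hM⟩ := (Set.finite_range r).bddAbove
  have hM' : ∀ x, r x < M + 1 := fun x => Nat.lt_succ_of_le (hM ⟨x, rfl⟩)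
  refine ⟨fun x => if x = v then M + 1 else r x, ?_, ?_⟩
  · intro x hx y hy hxy
    dsimp only at hxy
    split_ifs at hxy with h1 h2 h2
    · rw [h1, h2]
    · exact absurd hxy (hM' y).ne'
    · exact absurd hxy (hM' x).ne
    · exact hinj ⟨hx, h1⟩ ⟨hy, h2⟩ hxy
  · intro x hx hxE
    by_cases hxv : x = v
    · subst hxv
      rw [← ho]
      have : {w | w ∈ A ∧ G.Adj x w ∧ (if w = x then M + 1 else r w) <
          (if x = x then M + 1 else r x)} = nbrsIn G A x := by
        ext w
        simp only [Set.mem_ofPred_eq, nbrsIn, if_true]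
        constructor
        · rintro ⟨a, b, _⟩
          exact ⟨a, b⟩
        · rintro ⟨a, b⟩
          exact ⟨a, b, by rw [if_neg b.ne']; exact hM' w⟩
      rw [this]
    · rw [← hr x ⟨hx, hxv⟩ hxE]
      have : {w | w ∈ A ∧ G.Adj x w ∧ (if w = v then M + 1 else r w) <
          (if x = v then M + 1 else r x)} = {w | w ∈ A \ {v} ∧ G.Adj x w ∧ r w < r x} := by
        ext w
        simp only [Set.mem_ofPred_eq, Set.mem_sdiff, Set.mem_singleton_iff, if_neg hxv]
        by_cases hw : w = v
        · simp [hw, (hM' x).le]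
        · simp [hw]
      rw [this]

theorem Ranked.insert_first {E A T : Set V} {v : V} (hv : v ∈ A) (hT : v ∉ T)
    (h : Ranked G E (A \ {v}) (symmDiff T (nbrsIn G A v))) : Ranked G E A T := by
  classical
  obtain ⟨r, hinj, hr⟩ := h
  refine ⟨fun x => if x = v then 0 else r x + 1, ?_, ?_⟩
  · intro x hx y hy hxy
    dsimp only at hxy
    split_ifs at hxy with h1 h2 h2
    · rw [h1, h2]
    · exact hinj ⟨hx, h1⟩ ⟨hy, h2⟩ (Nat.succ_injective hxy)
  · intro x hx hxE
    by_cases hxv : x = v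
    · subst hxv
      simp [hT]
    · have key := hr x ⟨hx, hxv⟩ hxE
      have e1 : ∀ w, (w ∈ A ∧ G.Adj x w ∧ (if w = v then 0 else r w + 1) <
          (if x = v then 0 else r x + 1)) ↔
          (w = v ∧ G.Adj x v) ∨ (w ∈ A \ {v} ∧ G.Adj x w ∧ r w < r x) := by
        intro w
        by_cases hw : w = v
        · subst hw
          simp [hv, hxv]
        · simp [hw, hxv]
      simp only [e1]
      by_cases ha : G.Adj x v
      · have : {w | (w = v ∧ G.Adj x v) ∨ (w ∈ A \ {v} ∧ G.Adj x w ∧ r w < r x)} =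
            insert v {w | w ∈ A \ {v} ∧ G.Adj x w ∧ r w < r x} := by
          ext w
          simp [ha]
        rw [this, Set.ncard_insert_of_notMem (by simp), Nat.odd_add_one, key]
        simp [Set.mem_symmDiff, nbrsIn, ha.symm, hx]
      · have : {w | (w = v ∧ G.Adj x v) ∨ (w ∈ A \ {v} ∧ G.Adj x w ∧ r w < r x)} =
            {w | w ∈ A \ {v} ∧ G.Adj x w ∧ r w < r x} := by
          ext w
          simp [ha]
        rw [this, key]
        have ha' : ¬ G.Adj v x := fun h => ha h.symm
        simp [Set.mem_symmDiff, nbrsIn, ha']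

theorem Red.ranked {E A B : Set V} (h : Red G A B) (hB : ∀ T, Ranked G E B T) (T : Set V) :
    Ranked G E A T := by
  induction h generalizing T with
  | refl => exact hB T
  | @step A B v hv ho _ ih =>
    by_cases hT : v ∈ T
    · exact Ranked.insert_last hv (by simp [ho, hT]) (ih hB T)
    · exact Ranked.insert_first hv hT (ih hB _)

theorem Good.ranked {A : Set V} (h : Good G A) : ∃ r, ∀ T, Ranked G {r} A T := by
  obtain ⟨r, h⟩ := h
  refine ⟨r, h.ranked fun T => ⟨fun _ => 0, ?_, ?_⟩⟩
  · simp
  · intro v hv hv'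
    exact absurd hv hv'

theorem Ranked.hasAcyclicTOddOrientation {T : Set V} {x : V} (h : Ranked G {x} Set.univ T)
    (hP : CondP G T) : HasAcyclicTOddOrientation G T := by
  classical
  have := Fintype.ofFinite V
  obtain ⟨r, hinj, hr⟩ := h
  have hinj' : Function.Injective r := Set.injOn_univ.1 hinj
  set o := rankOrientation G r hinj' with ho
  have key : ∀ v, v ≠ x → (Odd (o.indeg v) ↔ v ∈ T) := by
    intro v hv
    rw [← hr v trivial hv]
    simp [GraphOrientation.indeg, ho, rankOrientation, G.adj_comm v]
  refine ⟨o, rankOrientation_acyclic r hinj', fun v => ?_⟩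
  by_cases hv : v = x
  swap
  · exact key v hv
  subst hv
  have hsum : (Odd (∑ w, (o.indeg w + if w ∈ T then 1 else 0)) ↔
      Odd (o.indeg v + if v ∈ T then 1 else 0)) := by
    rw [← Finset.add_sum_erase _ _ (Finset.mem_univ v), Nat.odd_add]
    have : Even (∑ w ∈ Finset.univ.erase v, (o.indeg w + if w ∈ T then 1 else 0)) := by
      refine Finset.even_sum _ fun w hw => ?_
      have := key w (Finset.ne_of_mem_erase hw)
      by_cases hT : w ∈ T
      · simp only [hT, iff_true, if_true] at this ⊢
        exact this.add_one
      · simpa [hT] using this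
    simp [this]
  have hE : Even (∑ w, (o.indeg w + if w ∈ T then 1 else 0)) := by
    rw [Finset.sum_add_distrib, o.sum_indeg]
    rw [Finset.sum_boole, Nat.cast_id, ← Set.ncard_coe_finset]
    simpa [CondP] using hP
  have hE' : ¬ Odd (o.indeg v + if v ∈ T then 1 else 0) :=
    fun h => Nat.not_even_iff_odd.2 (hsum.2 h) hE
  by_cases hT : v ∈ T
  · rw [if_pos hT, Nat.odd_add_one, not_not] at hE'
    simp [hE', hT]
  · rw [if_neg hT, add_zero] at hE'
    simp [hE', hT]

end Abstract

section Torus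

/-- Adjacency of `i` and `j` in the cycle on `0, …, p - 1`. -/
def cycAdj (p i j : ℕ) : Prop :=
  i < p ∧ j < p ∧ i ≠ j ∧ (j = i + 1 ∨ i = j + 1 ∨ (i = 0 ∧ j + 1 = p) ∨ (j = 0 ∧ i + 1 = p))

/-- The torus on `{0, …, p - 1} × {0, …, q - 1}`, with vertices in `ℕ × ℕ`. -/
def torusGraph (p q : ℕ) : SimpleGraph (ℕ × ℕ) where
  Adj x y := (x.1 = y.1 ∧ cycAdj q x.2 y.2) ∨ (x.2 = y.2 ∧ cycAdj p x.1 y.1)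
  symm := ⟨fun x y h => by simp only [cycAdj] at h ⊢; omega⟩
  loopless := ⟨fun x h => by simp only [cycAdj] at h; omega⟩

/-- Cyclic successor in `0, …, p - 1`. -/
abbrev cycSucc (p i : ℕ) : ℕ := if i + 1 = p then 0 else i + 1

/-- Cyclic predecessor in `0, …, p - 1`. -/
abbrev cycPred (p i : ℕ) : ℕ := if i = 0 then p - 1 else i - 1

theorem odd_ncard_of_four {α : Type*} {a b c d : α} (hab : a ≠ b) (hac : a ≠ c) (had : a ≠ d)
    (hbc : b ≠ c) (hbd : b ≠ d) (hcd : c ≠ d) (A : Set α) :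
    Odd {w | w ∈ A ∧ (w = a ∨ w = b ∨ w = c ∨ w = d)}.ncard ↔
      ¬ (((a ∈ A) ↔ (b ∈ A)) ↔ ((c ∈ A) ↔ (d ∈ A))) := by
  classical
  have : {w | w ∈ A ∧ (w = a ∨ w = b ∨ w = c ∨ w = d)} =
      (({a, b, c, d} : Finset α).filter (· ∈ A) : Set α) := by
    ext w
    simp [and_comm]
  rw [this, Set.ncard_coe_finset, Finset.card_filter, Finset.sum_insert (by simp [*]),
    Finset.sum_insert (by simp [*]), Finset.sum_insert (by simp [*]), Finset.sum_singleton]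
  by_cases a ∈ A <;> by_cases b ∈ A <;> by_cases c ∈ A <;> by_cases d ∈ A <;> simp [*] <;> decide

theorem odd_ncard_torus {p q i j : ℕ} (hp : 3 ≤ p) (hq : 3 ≤ q) (hi : i < p) (hj : j < q)
    (A : Set (ℕ × ℕ)) :
    Odd {w | w ∈ A ∧ (torusGraph p q).Adj (i, j) w}.ncard ↔
      ¬ (((cycSucc p i, j) ∈ A ↔ (cycPred p i, j) ∈ A) ↔
        ((i, cycSucc q j) ∈ A ↔ (i, cycPred q j) ∈ A)) := by
  rw [← odd_ncard_of_four]
  · congr! 5 with ⟨x, y⟩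
    simp only [torusGraph, cycAdj, cycSucc, cycPred, Prod.mk.injEq]
    split_ifs <;> omega
  all_goals
    simp only [cycSucc, cycPred, ne_eq, Prod.mk.injEq]
    split_ifs <;> omega

/-- The subset of `ℕ × ℕ` cut out by a binary predicate. -/
def cells (P : ℕ → ℕ → Prop) : Set (ℕ × ℕ) := {x | P x.1 x.2}

/-- `Red` for the torus, on subsets given by predicates. -/
def TRed (p q : ℕ) (P Q : ℕ → ℕ → Prop) : Prop :=
  Red (torusGraph p q) (cells P) (cells Q)

/-- `Good` for the torus, on subsets given by predicates. -/
def TGood (p q : ℕ) (P : ℕ → ℕ → Prop) : Prop :=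
  Good (torusGraph p q) (cells P)

variable {p q : ℕ} {P Q R : ℕ → ℕ → Prop}

theorem TRed.of_iff (h : ∀ x y, P x y ↔ Q x y) : TRed p q P Q := by
  have : P = Q := by
    ext x y
    exact h x y
  subst this
  exact Red.refl _

theorem TRed.trans (h : TRed p q P Q) (h' : TRed p q Q R) : TRed p q P R :=
  Red.trans h h'

theorem TRed.good (h : TRed p q P Q) (h' : TGood p q Q) : TGood p q P :=
  Red.good h h'

theorem TGood.congr (h' : TGood p q Q) (h : ∀ x y, P x y ↔ Q x y) : TGood p q P :=
  (TRed.of_iff h).good h'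

theorem TGood.single (a b : ℕ) (h : ∀ x y, P x y ↔ x = a ∧ y = b) : TGood p q P := by
  refine ⟨(a, b), ?_⟩
  have : cells P = {(a, b)} := by
    ext ⟨x, y⟩
    simpa [cells] using h x y
  rw [this]
  exact Red.refl _

/-- Deletion of a single vertex. -/
theorem TRed.cell (hp : 3 ≤ p) (hq : 3 ≤ q) (i j : ℕ) (hi : i < p) (hj : j < q) (hv : P i j)
    (ho : ¬ ((P (cycSucc p i) j ↔ P (cycPred p i) j) ↔ (P i (cycSucc q j) ↔ P i (cycPred q j))))
    (hQ : ∀ x y, Q x y ↔ P x y ∧ ¬ (x = i ∧ y = j)) : TRed p q P Q := by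
  refine Red.step (v := (i, j)) hv ((odd_ncard_torus hp hq hi hj (cells P)).2 ho) ?_
  have : cells P \ {(i, j)} = cells Q := by
    ext ⟨x, y⟩
    simp [cells, hQ]
  rw [this]
  exact Red.refl _

theorem TRed.swap (h : TRed p q P Q) : TRed q p (fun x y => P y x) (fun x y => Q y x) := by
  refine Red.preimage (G := torusGraph q p) Prod.swap Prod.swap_injective h ?_ ?_
  · simp [Prod.swap_surjective.range_eq]
  · rintro ⟨a, b⟩ ⟨c, d⟩ - -
    simp only [torusGraph, Prod.swap]
    tauto

theorem TGood.swap (h : TGood p q P) : TGood q p (fun x y => P y x) := by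
  refine Good.preimage (G := torusGraph q p) Prod.swap Prod.swap_injective h ?_ ?_
  · simp [Prod.swap_surjective.range_eq]
  · rintro ⟨a, b⟩ ⟨c, d⟩ - -
    simp only [torusGraph, Prod.swap]
    tauto

/-- Deletion of consecutive vertices of a column, from top to bottom. -/
theorem TRed.zip_down (hp : 3 ≤ p) (hq : 3 ≤ q) (a s n : ℕ) (ha : a < p) (hs : s + n < q)
    (h0 : ¬ R a (cycPred q s)) (h1 : R a (s + n)) (h2 : ∀ j, s ≤ j → j < s + n → ¬ R a j)
    (h3 : ∀ j, s ≤ j → j < s + n → (R (cycSucc p a) j ↔ R (cycPred p a) j))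
    (hP : ∀ x y, P x y ↔ R x y ∨ (x = a ∧ s ≤ y ∧ y < s + n)) : TRed p q P R := by
  induction n generalizing s P with
  | zero => exact TRed.of_iff fun x y => by rw [hP]; grind
  | succ n ih =>
    refine TRed.trans (Q := fun x y => R x y ∨ (x = a ∧ s + 1 ≤ y ∧ y < s + 1 + n))
      (TRed.cell hp hq a s ha (by omega) ?_ ?_ ?_)
      (ih (s + 1) (by omega) ?_ ?_ ?_ ?_ fun x y => Iff.rfl)
    all_goals grind

/-- Deletion of consecutive vertices of a column, from bottom to top. -/
theorem TRed.zip_up (hp : 3 ≤ p) (hq : 3 ≤ q) (a s n : ℕ) (ha : a < p) (hs : s + 1 + n ≤ q)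
    (h0 : n ≠ 0 → ¬ R a (cycSucc q (s + n))) (h1 : R a s)
    (h2 : ∀ j, s < j → j ≤ s + n → ¬ R a j)
    (h3 : ∀ j, s < j → j ≤ s + n → (R (cycSucc p a) j ↔ R (cycPred p a) j))
    (hP : ∀ x y, P x y ↔ R x y ∨ (x = a ∧ s < y ∧ y ≤ s + n)) : TRed p q P R := by
  induction n generalizing P with
  | zero => exact TRed.of_iff fun x y => by rw [hP]; grind
  | succ n ih =>
    refine TRed.trans (Q := fun x y => R x y ∨ (x = a ∧ s < y ∧ y ≤ s + n))
      (TRed.cell hp hq a (s + (n + 1)) ha (by omega) ?_ ?_ ?_)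
      (ih (by omega) ?_ ?_ ?_ fun x y => Iff.rfl)
    all_goals grind

/-- Deletion of an even number of consecutive vertices of a column, each of which has exactly
one horizontal neighbour. -/
theorem TRed.pairs (hp : 3 ≤ p) (hq : 3 ≤ q) (a s n : ℕ) (ha : a < p) (hs : s + 2 * n < q)
    (h0 : ¬ R a (cycPred q s)) (h1 : R a (s + 2 * n)) (h2 : ∀ j, s ≤ j → j < s + 2 * n → ¬ R a j)
    (h3 : ∀ j, s ≤ j → j < s + 2 * n → ¬ (R (cycSucc p a) j ↔ R (cycPred p a) j))
    (hP : ∀ x y, P x y ↔ R x y ∨ (x = a ∧ s ≤ y ∧ y < s + 2 * n)) : TRed p q P R := by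
  induction n generalizing s P with
  | zero => exact TRed.of_iff fun x y => by rw [hP]; grind
  | succ n ih =>
    refine TRed.trans (Q := fun x y => R x y ∨ (x = a ∧ s ≤ y ∧ y < s + 2 * (n + 1) ∧ y ≠ s + 1))
      (TRed.cell hp hq a (s + 1) ha (by omega) ?_ ?_ ?_) ?_
    rotate_left 3
    · refine TRed.trans (Q := fun x y => R x y ∨ (x = a ∧ s + 2 ≤ y ∧ y < s + 2 + 2 * n))
        (TRed.cell hp hq a s ha (by omega) ?_ ?_ ?_)
        (ih (s + 2) (by omega) ?_ ?_ ?_ ?_ fun x y => Iff.rfl)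
      all_goals grind
    · exact (hP _ _).2 (Or.inr ⟨rfl, by omega, by omega⟩)
    · have e1 : cycSucc q (s + 1) = s + 2 := by grind
      have e2 : cycPred q (s + 1) = s := by grind
      have e3 : cycSucc p a ≠ a := by grind
      have e4 : cycPred p a ≠ a := by grind
      have e5 := h3 (s + 1) (by omega) (by omega)
      have e6 : P a (s + 2) := by grind
      have e7 : P a s := by grind
      rw [e1, e2, hP, hP]
      simp only [e3, e4, e6, e7, false_and, or_false]
      tauto
    · grind

end Torus

section Cylinder

variable {p q : ℕ} {P Q R : ℕ → ℕ → Prop}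

/-- A grid with an odd number of rows is reducible. -/
theorem TGood.grid (hp : 3 ≤ p) (hq : 3 ≤ q) {a b c n : ℕ} (hab : a < b) (hb : b ≤ p)
    (hd : c + 2 * n + 1 ≤ q) (ha : 0 < a ∨ b < p) (hc : 0 < c ∨ c + 2 * n + 1 < q) :
    TGood p q fun x y => a ≤ x ∧ x < b ∧ c ≤ y ∧ y < c + 2 * n + 1 := by
  obtain ⟨m, rfl⟩ : ∃ m, b = a + 1 + m := ⟨b - a - 1, by omega⟩
  induction m generalizing a with
  | zero =>
    refine (TRed.zip_down (R := fun x y => x = a ∧ y = c + 2 * n) hp hq a c (2 * n)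
      ?_ ?_ ?_ ?_ ?_ ?_ ?_).good (TGood.single a (c + 2 * n) fun x y => Iff.rfl)
    all_goals grind
  | succ m ih =>
    refine ((TRed.pairs (R := fun x y => (a + 1 ≤ x ∧ x < a + 1 + (m + 1) ∧ c ≤ y ∧
      y < c + 2 * n + 1) ∨ (x = a ∧ y = c + 2 * n)) hp hq a c n ?_ ?_ ?_ ?_ ?_ ?_ ?_).trans
      (TRed.cell (Q := fun x y => a + 1 ≤ x ∧ x < a + 1 + (m + 1) ∧ c ≤ y ∧
      y < c + 2 * n + 1) hp hq a (c + 2 * n) ?_ ?_ ?_ ?_ ?_)).good ?_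
    rotate_right
    · have := ih (a := a + 1) (by omega) (by omega) (by omega)
      exact this.congr fun x y => by omega
    all_goals grind

/-- A grid with an odd number of columns is reducible. -/
theorem TGood.grid' (hp : 3 ≤ p) (hq : 3 ≤ q) {a c d n : ℕ} (hcd : c < d) (hd : d ≤ q)
    (hb : a + 2 * n + 1 ≤ p) (hc : 0 < c ∨ d < q) (ha : 0 < a ∨ a + 2 * n + 1 < p) :
    TGood p q fun x y => a ≤ x ∧ x < a + 2 * n + 1 ∧ c ≤ y ∧ y < d :=
  (TGood.grid hq hp hcd hd hb hc ha).swap.congr fun x y => by omega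

/-- Removal of the first two columns of a cylinder, once all but the last vertex of the first one
have been deleted. -/
theorem TRed.two_columns (hp : 3 ≤ p) (hq : 3 ≤ q) {s n : ℕ} (he : s + 2 * n + 2 ≤ q)
    (hR0 : ∀ j, s ≤ j → j < s + 2 * n + 2 → ¬ R 0 j)
    (hR1 : ∀ j, s ≤ j → j < s + 2 * n + 2 → ¬ R 1 j)
    (hR2 : ∀ j, s ≤ j → j < s + 2 * n + 2 → R 2 j)
    (h0 : ¬ R 0 (cycSucc q (s + 2 * n + 1))) (h1 : ¬ R 1 (cycSucc q (s + 2 * n + 1)))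
    (h2 : ¬ R 1 (cycPred q s)) (h3 : R (p - 1) (s + 2 * n + 1)) (hw : 0 < s ∨ s + 2 * n + 2 < q)
    (hP : ∀ x y, P x y ↔ R x y ∨ (x = 0 ∧ y = s + 2 * n + 1) ∨
      (x = 1 ∧ s ≤ y ∧ y < s + 2 * n + 2)) : TRed p q P R := by
  have h4 : ¬ R 1 (cycPred q (s + 2 * n)) := by
    rcases Nat.eq_zero_or_pos n with rfl | hn
    · exact h2
    · grind
  refine (TRed.pairs (R := fun x y => R x y ∨ (x = 0 ∧ y = s + 2 * n + 1) ∨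
      (x = 1 ∧ s + 2 * n ≤ y ∧ y < s + 2 * n + 2)) hp hq 1 s n ?_ ?_ ?_ ?_ ?_ ?_ ?_).trans
    ((TRed.cell (Q := fun x y => R x y ∨ (x = 0 ∧ y = s + 2 * n + 1) ∨
      (x = 1 ∧ y = s + 2 * n)) hp hq 1 (s + 2 * n + 1) ?_ ?_ ?_ ?_ ?_).trans
    ((TRed.cell (Q := fun x y => R x y ∨ (x = 0 ∧ y = s + 2 * n + 1))
      hp hq 1 (s + 2 * n) ?_ ?_ ?_ ?_ ?_).trans
    (TRed.cell hp hq 0 (s + 2 * n + 1) ?_ ?_ ?_ ?_ ?_)))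
  all_goals grind

end Cylinder

section Regions

variable {p q : ℕ} {P Q R : ℕ → ℕ → Prop}

/-- If `p` is odd, a cylinder over `C_p` with an even number of rows is reducible. -/
theorem TGood.cylinder (hq : 3 ≤ q) {c k n : ℕ} (hp : p = 2 * k + 3) (hd : c + 2 * n + 2 ≤ q)
    (hw : 0 < c ∨ c + 2 * n + 2 < q) :
    TGood p q fun x y => x < p ∧ c ≤ y ∧ y < c + 2 * n + 2 := by
  refine ((TRed.zip_down (R := fun x y => (1 ≤ x ∧ x < p ∧ c ≤ y ∧ y < c + 2 * n + 2) ∨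
      (x = 0 ∧ y = c + 2 * n + 1)) (by omega) hq 0 c (2 * n + 1) ?_ ?_ ?_ ?_ ?_ ?_ ?_).trans
    (TRed.two_columns (R := fun x y => 2 ≤ x ∧ x < 2 + 2 * k + 1 ∧ c ≤ y ∧ y < c + 2 * n + 2)
      (s := c) (n := n) (by omega) hq ?_ ?_ ?_ ?_ ?_ ?_ ?_ ?_ ?_ ?_)).good
    (TGood.grid' (by omega) hq ?_ ?_ ?_ ?_ ?_)
  all_goals grind

/-- If `p` is odd, a cylinder over `C_p` with an even number of rows is reducible after removal of
a vertex of the first row. -/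
theorem TGood.cylinder_sdiff_end (hq : 3 ≤ q) {c k n : ℕ} (hp : p = 2 * k + 3)
    (hd : c + 2 * n + 2 ≤ q) (hw : 0 < c ∨ c + 2 * n + 2 < q) :
    TGood p q fun x y => x < p ∧ c ≤ y ∧ y < c + 2 * n + 2 ∧ ¬ (x = 0 ∧ y = c) := by
  refine ((TRed.zip_down (R := fun x y => (1 ≤ x ∧ x < p ∧ c ≤ y ∧ y < c + 2 * n + 2) ∨
      (x = 0 ∧ y = c + 2 * n + 1)) (by omega) hq 0 (c + 1) (2 * n) ?_ ?_ ?_ ?_ ?_ ?_ ?_).trans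
    (TRed.two_columns (R := fun x y => 2 ≤ x ∧ x < 2 + 2 * k + 1 ∧ c ≤ y ∧ y < c + 2 * n + 2)
      (s := c) (n := n) (by omega) hq ?_ ?_ ?_ ?_ ?_ ?_ ?_ ?_ ?_ ?_)).good
    (TGood.grid' (by omega) hq ?_ ?_ ?_ ?_ ?_)
  all_goals grind

/-- Deletion of a row that is a cycle of even length, each of whose vertices has exactly one
vertical neighbour. -/
theorem TRed.ring_row (hq : 3 ≤ q) {e k : ℕ} (hp : p = 2 * k + 4) (he : e < q)
    (h1 : ∀ x, x < p → ¬ R x e)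
    (h2 : ∀ x, x < p → ¬ (R x (cycSucc q e) ↔ R x (cycPred q e)))
    (hP : ∀ x y, P x y ↔ R x y ∨ (x < p ∧ y = e)) : TRed p q P R := by
  have hs : cycSucc q e ≠ e := by grind
  have hr : cycPred q e ≠ e := by grind
  refine (TRed.cell (Q := fun x y => R x y ∨ (1 ≤ x ∧ x < p ∧ y = e)) (by omega) hq 0 e
      ?_ ?_ ?_ ?_ ?_).trans
    ((TRed.swap (TRed.pairs (P := fun y x => R x y ∨ (1 ≤ x ∧ x < p ∧ y = e))
      (R := fun y x => R x y ∨ (x = p - 1 ∧ y = e)) hq (by omega) e 1 (k + 1)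
        ?_ ?_ ?_ ?_ ?_ ?_ ?_)).trans
    (TRed.cell (by omega) hq (p - 1) e ?_ ?_ ?_ ?_ ?_))
  all_goals grind

/-- A cylinder with an odd number of rows is reducible after removal of a vertex of an inner row. -/
theorem TGood.cylinder_sdiff_inner (hp : 3 ≤ p) (hq : 3 ≤ q) {c m n : ℕ}
    (hd : c + 2 * n + 3 ≤ q) (hw : 0 < c ∨ c + 2 * n + 3 < q) (hm : c < m)
    (hm' : m < c + 2 * n + 2) :
    TGood p q fun x y => x < p ∧ c ≤ y ∧ y < c + 2 * n + 3 ∧ ¬ (x = 0 ∧ y = m) := by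
  refine ((TRed.zip_up (R := fun x y => (1 ≤ x ∧ x < p ∧ c ≤ y ∧ y < c + 2 * n + 3) ∨
      (x = 0 ∧ m < y ∧ y < c + 2 * n + 3) ∨ (x = 0 ∧ y = c)) hp hq 0 c (m - 1 - c)
      ?_ ?_ ?_ ?_ ?_ ?_ ?_).trans
    ((TRed.zip_down (R := fun x y => (1 ≤ x ∧ x < p ∧ c ≤ y ∧ y < c + 2 * n + 3) ∨
      (x = 0 ∧ y = c + 2 * n + 2) ∨ (x = 0 ∧ y = c)) hp hq 0 (m + 1) (c + 2 * n + 1 - m)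
      ?_ ?_ ?_ ?_ ?_ ?_ ?_).trans
    ((TRed.cell (Q := fun x y => (1 ≤ x ∧ x < p ∧ c ≤ y ∧ y < c + 2 * n + 3 ∧ ¬ (x = 1 ∧ y = c)) ∨
      (x = 0 ∧ y = c + 2 * n + 2) ∨ (x = 0 ∧ y = c)) hp hq 1 c ?_ ?_ ?_ ?_ ?_).trans
    ((TRed.cell (Q := fun x y => (1 ≤ x ∧ x < p ∧ c ≤ y ∧ y < c + 2 * n + 3 ∧ ¬ (x = 1 ∧ y = c)) ∨
      (x = 0 ∧ y = c + 2 * n + 2)) hp hq 0 c ?_ ?_ ?_ ?_ ?_).trans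
    ((TRed.cell (Q := fun x y => (2 ≤ x ∧ x < p ∧ c ≤ y ∧ y < c + 2 * n + 3) ∨
      (x = 1 ∧ c + 1 ≤ y ∧ y < c + 2 * n + 2) ∨
      (x = 0 ∧ y = c + 2 * n + 2)) hp hq 1 (c + 2 * n + 2) ?_ ?_ ?_ ?_ ?_).trans
    ((TRed.cell (Q := fun x y => (2 ≤ x ∧ x < p ∧ c ≤ y ∧ y < c + 2 * n + 3) ∨
      (x = 1 ∧ c + 1 ≤ y ∧ y < c + 2 * n + 2)) hp hq 0 (c + 2 * n + 2) ?_ ?_ ?_ ?_ ?_).trans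
    ((TRed.pairs (R := fun x y => (2 ≤ x ∧ x < p ∧ c ≤ y ∧ y < c + 2 * n + 3) ∨
      (x = 1 ∧ y = c + 2 * n + 1)) hp hq 1 (c + 1) n ?_ ?_ ?_ ?_ ?_ ?_ ?_).trans
    (TRed.cell (Q := fun x y => 2 ≤ x ∧ x < p ∧ c ≤ y ∧ y < c + 2 * (n + 1) + 1) hp hq 1
      (c + 2 * n + 1) ?_ ?_ ?_ ?_ ?_)))))))).good
    (TGood.grid hp hq ?_ ?_ ?_ ?_ ?_)
  all_goals grind

/-- A cylinder with an odd number of rows is reducible after removal of two adjacent vertices of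
the first row. -/
theorem TGood.cylinder_sdiff_pair (hp : 3 ≤ p) (hq : 3 ≤ q) {c n : ℕ}
    (hd : c + 2 * n + 3 ≤ q) (hw : 0 < c ∨ c + 2 * n + 3 < q) :
    TGood p q fun x y => x < p ∧ c ≤ y ∧ y < c + 2 * n + 3 ∧ ¬ (x ≤ 1 ∧ y = c) := by
  refine ((TRed.zip_down (R := fun x y => (2 ≤ x ∧ x < p ∧ c ≤ y ∧ y < c + 2 * n + 3) ∨
      (x = 0 ∧ y = c + 2 * n + 2) ∨ (x = 1 ∧ c + 1 ≤ y ∧ y < c + 2 * n + 3)) hp hq 0 (c + 1)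
      (2 * n + 1) ?_ ?_ ?_ ?_ ?_ ?_ ?_).trans
    (TRed.two_columns (R := fun x y => 2 ≤ x ∧ x < p ∧ c ≤ y ∧ y < c + 2 * (n + 1) + 1)
      (s := c + 1) (n := n) hp hq ?_ ?_ ?_ ?_ ?_ ?_ ?_ ?_ ?_ ?_)).good
    (TGood.grid hp hq ?_ ?_ ?_ ?_ ?_)
  all_goals grind

/-- If `p` is even, a cylinder over `C_p` with an even number of rows is reducible after removal
of a vertex of an inner row. -/
theorem TGood.cylinder_sdiff_inner_even (hq : 3 ≤ q) {c m k n : ℕ} (hp : p = 2 * k + 4)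
    (hd : c + 2 * n + 4 ≤ q) (hw : 0 < c ∨ c + 2 * n + 4 < q) (hm : c < m)
    (hm' : m < c + 2 * n + 3) :
    TGood p q fun x y => x < p ∧ c ≤ y ∧ y < c + 2 * n + 4 ∧ ¬ (x = 0 ∧ y = m) := by
  rcases Nat.lt_or_ge m (c + 2 * n + 2) with h | h
  · refine TRed.good (TRed.ring_row (e := c + 2 * n + 3) hq hp ?_ ?_ ?_ ?_)
      (TGood.cylinder_sdiff_inner (c := c) (m := m) (n := n) (by omega) hq ?_ ?_ ?_ ?_)
    all_goals grind
  · refine TRed.good (TRed.ring_row (e := c) hq hp ?_ ?_ ?_ ?_)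
      (TGood.cylinder_sdiff_inner (c := c + 1) (m := m) (n := n) (by omega) hq ?_ ?_ ?_ ?_)
    all_goals grind

/-- If `p` is even, a cylinder over `C_p` with an even number of rows is reducible after removal
of two adjacent vertices of the first row. -/
theorem TGood.cylinder_sdiff_pair_even (hq : 3 ≤ q) {c k n : ℕ} (hp : p = 2 * k + 4)
    (hd : c + 2 * n + 2 ≤ q) (hw : 0 < c ∨ c + 2 * n + 2 < q) :
    TGood p q fun x y => x < p ∧ c ≤ y ∧ y < c + 2 * n + 2 ∧ ¬ (x ≤ 1 ∧ y = c) := by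
  rcases n with - | n
  · refine ((TRed.cell (Q := fun x y => x < p ∧ c ≤ y ∧ y < c + 2 ∧ ¬ (x ≤ 1 ∧ y = c) ∧
        ¬ (x = 2 ∧ y = c + 1)) (by omega) hq 2 (c + 1) ?_ ?_ ?_ ?_ ?_).trans
      ((TRed.cell (Q := fun x y => x < p ∧ c ≤ y ∧ y < c + 2 ∧ ¬ (x ≤ 2 ∧ y = c) ∧
        ¬ (x = 2 ∧ y = c + 1)) (by omega) hq 2 c ?_ ?_ ?_ ?_ ?_).trans
      ((TRed.cell (Q := fun x y => x < p ∧ c ≤ y ∧ y < c + 2 ∧ ¬ (x ≤ 2 ∧ y = c) ∧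
        ¬ ((x = 1 ∨ x = 2) ∧ y = c + 1)) (by omega) hq 1 (c + 1) ?_ ?_ ?_ ?_ ?_).trans
      (TRed.cell (Q := fun x y => 3 ≤ x ∧ x < 3 + 2 * k + 1 ∧ c ≤ y ∧ y < c + 2) (by omega) hq 0
        (c + 1) ?_ ?_ ?_ ?_ ?_)))).good (TGood.grid' (by omega) hq ?_ ?_ ?_ ?_ ?_)
    all_goals grind
  · refine TRed.good (TRed.ring_row (e := c + 2 * n + 3) hq hp ?_ ?_ ?_ ?_)
      (TGood.cylinder_sdiff_pair (c := c) (n := n) (by omega) hq ?_ ?_)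
    all_goals grind

end Regions

section TorusRegions

variable {p q : ℕ} {P Q R : ℕ → ℕ → Prop}

/-- If `p` is even, the torus is reducible after removal of a vertex. -/
theorem TGood.torus_sdiff (hq : 3 ≤ q) {k : ℕ} (hp : p = 2 * k + 4) :
    TGood p q fun x y => x < p ∧ y < q ∧ ¬ (x = 0 ∧ y = 0) := by
  refine ((TRed.zip_up (R := fun x y => (1 ≤ x ∧ x < p ∧ y < q) ∨ (x = 0 ∧ y = 1))
      (by omega) hq 0 1 (q - 2) ?_ ?_ ?_ ?_ ?_ ?_ ?_).trans
    ((TRed.cell (Q := fun x y => (1 ≤ x ∧ x < p ∧ y < q ∧ ¬ (x = 1 ∧ y = 0)) ∨ (x = 0 ∧ y = 1))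
      (by omega) hq 1 0 ?_ ?_ ?_ ?_ ?_).trans
    ((TRed.cell (Q := fun x y => (1 ≤ x ∧ x < p ∧ y < q ∧ ¬ (x = 1 ∧ y ≤ 1)) ∨ (x = 0 ∧ y = 1))
      (by omega) hq 1 1 ?_ ?_ ?_ ?_ ?_).trans
    (TRed.cell (Q := fun x y => y < q ∧ 1 ≤ x ∧ x < 1 + 2 * k + 3 ∧ ¬ (y ≤ 1 ∧ x = 1))
      (by omega) hq 0 1 ?_ ?_ ?_ ?_ ?_)))).good
    (TGood.swap (TGood.cylinder_sdiff_pair hq (by omega) ?_ ?_))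
  all_goals grind

/-- If `p` and `q` are odd, the torus is reducible after removal of two vertices at distance two
in different rows and columns. -/
theorem TGood.torus_sdiff_diagonal {k l : ℕ} (hp : p = 2 * k + 3) (hq : q = 2 * l + 3) :
    TGood p q fun x y => x < p ∧ y < q ∧ ¬ (x = 1 ∧ y = 0) ∧ ¬ (x = 0 ∧ y = q - 1) := by
  refine ((TRed.zip_up (R := fun x y => (x < p ∧ y < q ∧ ¬ (x = 1 ∧ y = 0) ∧ ¬ (x = 0 ∧ 1 ≤ y)))
      (by omega) (by omega) 0 0 (q - 2) ?_ ?_ ?_ ?_ ?_ ?_ ?_).trans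
    (TRed.cell (Q := fun x y => y < q ∧ 1 ≤ x ∧ x < 1 + 2 * k + 2 ∧ ¬ (y = 0 ∧ x = 1))
      (by omega) (by omega) 0 0 ?_ ?_ ?_ ?_ ?_)).good
    (TGood.swap (TGood.cylinder_sdiff_end (by omega) hq ?_ ?_))
  all_goals grind

/-- Rotation of `0, …, q - 1` moving `b` to `0`. -/
def rotateTo (q b y : ℕ) : ℕ := if q ≤ y then y else if b ≤ y then y - b else y + q - b

theorem rotateTo_injective {b : ℕ} (hb : b < q) : Function.Injective (rotateTo q b) := by
  intro x y h
  simp only [rotateTo] at h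
  split_ifs at h <;> omega

theorem cycAdj_rotateTo {b x y : ℕ} (hb : b < q) (hx : x < q) (hy : y < q) :
    cycAdj q x y ↔ cycAdj q (rotateTo q b x) (rotateTo q b y) := by
  simp only [cycAdj, rotateTo, not_le.2 hx, not_le.2 hy, if_false]
  split_ifs <;> omega

theorem TGood.rotate {b : ℕ} (h : TGood p q P) (hP : ∀ x y, P x y → y < q) (hb : b < q) :
    TGood p q fun x y => P x (rotateTo q b y) := by
  have hlt : ∀ x, rotateTo q b x < q → x < q := by
    intro x h
    by_contra hc
    simp only [rotateTo, not_lt.1 hc, if_true] at h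
    omega
  refine Good.preimage (G := torusGraph p q) (fun x : ℕ × ℕ => (x.1, rotateTo q b x.2)) ?_ h ?_ ?_
  · rintro ⟨x, y⟩ ⟨x', y'⟩ h
    rw [Prod.mk.injEq] at h ⊢
    exact ⟨h.1, rotateTo_injective hb h.2⟩
  · rintro ⟨x, y⟩ h
    have := hP x y h
    refine ⟨(x, if y + b < q then y + b else y + b - q), ?_⟩
    simp only [Prod.mk.injEq, true_and, rotateTo]
    grind
  · rintro ⟨x, y⟩ ⟨x', y'⟩ h h'
    have h1 := hlt _ (hP _ _ h)
    have h2 := hlt _ (hP _ _ h')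
    change _ ∧ _ ∨ _ ∧ _ ↔ _ ∧ _ ∨ _ ∧ _
    simp only [(rotateTo_injective hb).eq_iff, cycAdj_rotateTo hb h1 h2]

/-- If `p` and `q` are odd, the torus is reducible after removal of two vertices in columns that
are far apart. -/
theorem TGood.torus_sdiff_far {a b k l : ℕ} (hp : p = 2 * k + 5) (hq : q = 2 * l + 3) (ha : 3 ≤ a)
    (ha' : a + 2 ≤ p) (hb : b < q) :
    TGood p q fun x y => x < p ∧ y < q ∧ ¬ (x = 0 ∧ y = 0) ∧ ¬ (x = a ∧ y = b) := by
  refine ((TRed.zip_down (R := fun x y => (1 ≤ x ∧ x < p ∧ y < q ∧ ¬ (x = a ∧ y = b)) ∨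
      (x = 0 ∧ y = q - 1)) (by omega) (by omega) 0 1 (q - 2) ?_ ?_ ?_ ?_ ?_ ?_ ?_).trans
    ((TRed.cell (Q := fun x y => (1 ≤ x ∧ x < p ∧ y < q ∧ ¬ (x = a ∧ y = b) ∧ ¬ (x = 1 ∧ y = 0)) ∨
      (x = 0 ∧ y = q - 1)) (by omega) (by omega) 1 0 ?_ ?_ ?_ ?_ ?_).trans
    (TRed.two_columns (R := fun x y => 2 ≤ x ∧ x < 2 + 2 * k + 3 ∧ y < q ∧ ¬ (x = a ∧ y = b))
      (s := 1) (n := l) (by omega) (by omega) ?_ ?_ ?_ ?_ ?_ ?_ ?_ ?_ ?_ ?_))).good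
    (TGood.congr (TGood.rotate (TGood.swap (TGood.cylinder_sdiff_inner (c := 2) (m := a) (n := k)
      (by omega) (by omega) ?_ ?_ ?_ ?_)) ?_ hb) ?_)
  rotate_right
  · intro x y
    simp only [rotateTo]
    grind
  all_goals grind

end TorusRegions

section Embeddings

variable {n m p q : ℕ}

/-- `φ` identifies the graph `H` on `Fin n` with the subgraph of the cycle on `0, …, p - 1`
induced by `0, …, n - 1`. -/
structure CycEmb (H : SimpleGraph (Fin n)) (p : ℕ) (φ : Fin n → ℕ) : Prop where
  inj : Function.Injective φ
  lt : ∀ i, φ i < n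
  surj : ∀ x < n, ∃ i, φ i = x
  adj : ∀ i j, H.Adj i j ↔ cycAdj p (φ i) (φ j)

theorem cycEmb_cycleGraph (hn : 3 ≤ n) : CycEmb (cycleGraph n) n Fin.val := by
  refine ⟨Fin.val_injective, Fin.isLt, fun x hx => ⟨⟨x, hx⟩, rfl⟩, fun i j => ?_⟩
  rw [cycleGraph_adj', Fin.val_sub, Fin.val_sub]
  have hi := i.isLt
  have hj := j.isLt
  have key : ∀ a b : ℕ, a < n → b < n → (n - b + a) % n = if b ≤ a then a - b else n - b + a := by
    intro a b ha hb
    split_ifs with h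
    · rw [show n - b + a = (a - b) + n by omega, Nat.add_mod_right, Nat.mod_eq_of_lt (by omega)]
    · exact Nat.mod_eq_of_lt (by omega)
  rw [key _ _ hi hj, key _ _ hj hi]
  simp only [cycAdj]
  split_ifs <;> omega

theorem cycEmb_pathGraph : CycEmb (pathGraph n) (n + 2) Fin.val := by
  refine ⟨Fin.val_injective, Fin.isLt, fun x hx => ⟨⟨x, hx⟩, rfl⟩, fun i j => ?_⟩
  rw [pathGraph_adj, cycAdj]
  omega

theorem cycEmb_pathGraph_rev : CycEmb (pathGraph n) (n + 2) fun i => n - 1 - i.val := by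
  refine ⟨fun i j h => ?_, fun i => by omega, fun x hx => ⟨⟨n - 1 - x, by omega⟩, ?_⟩,
    fun i j => ?_⟩
  · omega
  · change n - 1 - (n - 1 - x) = x
    omega
  · rw [pathGraph_adj, cycAdj]
    omega

theorem CycEmb.rotate {H : SimpleGraph (Fin n)} {φ : Fin n → ℕ} (h : CycEmb H n φ) (a : Fin n) :
    CycEmb H n fun i => rotateTo n (φ a) (φ i) := by
  have ha := h.lt a
  refine ⟨(rotateTo_injective ha).comp h.inj, fun i => ?_, fun x hx => ?_, fun i j => ?_⟩
  · have := h.lt i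
    simp only [rotateTo]
    split_ifs <;> omega
  · obtain ⟨i, hi⟩ := h.surj (if x + φ a < n then x + φ a else x + φ a - n) (by split_ifs <;> omega)
    refine ⟨i, ?_⟩
    rw [hi]
    simp only [rotateTo]
    split_ifs <;> omega
  · rw [h.adj, cycAdj_rotateTo ha (h.lt i) (h.lt j)]

theorem CycEmb.reflect {H : SimpleGraph (Fin n)} {φ : Fin n → ℕ} (h : CycEmb H n φ) :
    CycEmb H n fun i => if φ i = 0 then 0 else n - φ i := by
  refine ⟨fun i j hij => h.inj ?_, fun i => ?_, fun x hx => ?_, fun i j => ?_⟩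
  · have := h.lt i
    have := h.lt j
    split_ifs at hij <;> omega
  · have := h.lt i
    split_ifs <;> omega
  · obtain ⟨i, hi⟩ := h.surj (if x = 0 then 0 else n - x) (by split_ifs <;> omega)
    refine ⟨i, ?_⟩
    rw [hi]
    split_ifs <;> omega
  · have := h.lt i
    have := h.lt j
    rw [h.adj, cycAdj, cycAdj]
    grind

theorem exists_cycEmb (hn : 3 ≤ n) (a : Fin n) : ∃ φ, CycEmb (cycleGraph n) n φ ∧ φ a = 0 :=
  ⟨_, (cycEmb_cycleGraph hn).rotate a, by simp [rotateTo]⟩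

theorem exists_cycEmb_of_adj (hn : 3 ≤ n) {a b : Fin n} (h : (cycleGraph n).Adj a b) :
    ∃ φ, CycEmb (cycleGraph n) n φ ∧ φ a = 0 ∧ φ b = 1 := by
  obtain ⟨φ, hφ, ha⟩ := exists_cycEmb hn a
  have hab := (hφ.adj a b).1 h
  rw [cycAdj, ha] at hab
  rcases eq_or_ne (φ b) 1 with hb | hb
  · exact ⟨φ, hφ, ha, hb⟩
  · refine ⟨_, hφ.reflect, by simp [ha], ?_⟩
    rw [if_neg (by omega)]
    omega

theorem exists_cycEmb_of_not_adj (hn : 5 ≤ n) {a b : Fin n} (hne : a ≠ b)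
    (h : ¬ (cycleGraph n).Adj a b) :
    ∃ φ, CycEmb (cycleGraph n) n φ ∧ φ a = 0 ∧ 3 ≤ φ b ∧ φ b + 2 ≤ n := by
  obtain ⟨φ, hφ, ha⟩ := exists_cycEmb (by omega) a
  have hab : ¬ cycAdj n (φ a) (φ b) := fun h' => h ((hφ.adj a b).2 h')
  have hne' : φ b ≠ 0 := fun h' => hne (hφ.inj (by rw [ha, h']))
  have hlt := hφ.lt b
  rw [cycAdj, ha] at hab
  rcases eq_or_ne (φ b) 2 with hb | hb
  · exact ⟨_, hφ.reflect, by simp [ha], by rw [if_neg hne']; omega, by rw [if_neg hne']; omega⟩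
  · exact ⟨φ, hφ, ha, by omega, by omega⟩

theorem TGood.boxProd {H : SimpleGraph (Fin n)} {K : SimpleGraph (Fin m)} {φ : Fin n → ℕ}
    {ψ : Fin m → ℕ} {P : ℕ → ℕ → Prop} (h : TGood p q P) (hφ : CycEmb H p φ) (hψ : CycEmb K q ψ)
    (hP : ∀ x y, P x y → x < n ∧ y < m) {A : Set (Fin n × Fin m)}
    (hA : ∀ x, x ∈ A ↔ P (φ x.1) (ψ x.2)) : Good (H □ K) A := by
  have : A = Prod.map φ ψ ⁻¹' cells P := by
    ext x
    exact hA x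
  rw [this]
  refine Good.preimage (Prod.map φ ψ) (hφ.inj.prodMap hψ.inj) h ?_ ?_
  · rintro ⟨x, y⟩ hxy
    obtain ⟨i, rfl⟩ := hφ.surj x (hP x y hxy).1
    obtain ⟨j, rfl⟩ := hψ.surj y (hP _ y hxy).2
    exact ⟨(i, j), rfl⟩
  · rintro ⟨i, j⟩ ⟨i', j'⟩ - -
    simp only [boxProd_adj, hφ.adj, hψ.adj, torusGraph, Prod.map, hφ.inj.eq_iff, hψ.inj.eq_iff]
    tauto

end Embeddings

section Degrees

theorem vdeg_boxProd {V W : Type*} [Finite V] [Finite W] (G : SimpleGraph V) (H : SimpleGraph W)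
    (x : V × W) : vdeg (G □ H) x = vdeg G x.1 + vdeg H x.2 := by
  rw [vdeg, neighborSet_boxProd, Set.ncard_union_eq, Set.ncard_prod, Set.ncard_prod]
  · simp [vdeg]
  · rw [Set.disjoint_left]
    rintro ⟨a, b⟩ h h'
    simp only [Set.mem_prod, Set.mem_singleton_iff, mem_neighborSet] at h h'
    exact h.1.ne h'.1.symm

theorem vdeg_cycleGraph {n : ℕ} (hn : 3 ≤ n) (i : Fin n) : vdeg (cycleGraph n) i = 2 := by
  obtain ⟨m, rfl⟩ := Nat.exists_eq_add_of_le' hn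
  rw [← cycleGraph_degree_three_le (v := i), vdeg, ← card_neighborSet_eq_degree,
    Set.ncard_eq_toFinset_card', Set.toFinset_card]

theorem vdeg_pathGraph {n : ℕ} (i : Fin n) :
    vdeg (pathGraph n) i = (if i.val = 0 then 0 else 1) + if i.val + 1 = n then 0 else 1 := by
  have : (pathGraph n).neighborSet i = {j | j.val + 1 = i.val} ∪ {j | i.val + 1 = j.val} := by
    ext j
    simp only [mem_neighborSet, pathGraph_adj, Set.mem_union, Set.mem_ofPred_eq]
    omega
  rw [vdeg, this, Set.ncard_union_eq]
  · congr 1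
    · split_ifs with h
      · rw [Set.ncard_eq_zero]
        ext j
        simp [h]
      · rw [Set.ncard_eq_one]
        refine ⟨⟨i.val - 1, by omega⟩, ?_⟩
        ext j
        simp only [Set.mem_ofPred_eq, Set.mem_singleton_iff, Fin.ext_iff]
        omega
    · split_ifs with h
      · rw [Set.ncard_eq_zero]
        ext j
        simp only [Set.mem_ofPred_eq, Set.mem_empty_iff_false, iff_false]
        omega
      · rw [Set.ncard_eq_one]
        refine ⟨⟨i.val + 1, by omega⟩, ?_⟩
        ext j
        simp only [Set.mem_ofPred_eq, Set.mem_singleton_iff, Fin.ext_iff]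
        omega
  · rw [Set.disjoint_left]
    intro j h h'
    simp only [Set.mem_ofPred_eq] at h h'
    omega

theorem sum_vdeg {V : Type*} [Fintype V] (G : SimpleGraph V) :
    ∑ v, vdeg G v = 2 * G.edgeSet.ncard := by
  classical
  have := G.sum_degrees_eq_twice_card_edges
  rw [← coe_edgeFinset, Set.ncard_coe_finset, ← this]
  refine Finset.sum_congr rfl fun v _ => ?_
  rw [vdeg, ← card_neighborSet_eq_degree, Set.ncard_eq_toFinset_card', Set.toFinset_card]

theorem edgeSet_ncard_torus {p q : ℕ} (hp : 3 ≤ p) (hq : 3 ≤ q) :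
    (cycleGraph p □ cycleGraph q).edgeSet.ncard = 2 * (p * q) := by
  have := sum_vdeg (cycleGraph p □ cycleGraph q)
  simp only [vdeg_boxProd, vdeg_cycleGraph hp, vdeg_cycleGraph hq, Finset.sum_const,
    Finset.card_univ, Fintype.card_prod, Fintype.card_fin, smul_eq_mul] at this
  omega

theorem edgeSet_ncard_cylinder {p q : ℕ} (hp : 3 ≤ p) :
    (cycleGraph p □ pathGraph (q + 1)).edgeSet.ncard = p * (2 * q + 1) := by
  have := sum_vdeg (cycleGraph p □ pathGraph (q + 1))
  simp only [vdeg_boxProd, vdeg_cycleGraph hp, vdeg_pathGraph, Fintype.sum_prod_type,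
    Finset.sum_add_distrib] at this
  have h1 : ∑ x : Fin (q + 1), (if x.val = 0 then 0 else 1) = q := by
    rw [Fin.sum_univ_succ]
    simp
  have h2 : ∑ x : Fin (q + 1), (if x.val + 1 = q + 1 then 0 else 1) = q := by
    rw [Fin.sum_univ_castSucc]
    simp [Fin.val_castSucc, (Fin.is_lt _).ne]
  simp only [h1, h2, Finset.sum_const, Finset.card_univ, Fintype.card_fin, smul_eq_mul] at this
  linarith

end Degrees

section FirstVertices

variable {V : Type*} [Finite V] {G : SimpleGraph V} {T : Set V}

theorem Good.hasAcyclicTOddOrientation (h : Good G Set.univ) (hP : CondP G T) :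
    HasAcyclicTOddOrientation G T := by
  obtain ⟨r, hr⟩ := h.ranked
  exact (hr T).hasAcyclicTOddOrientation hP

theorem Good.hasAcyclicTOddOrientation_of_notMem {v : V} (h : Good G {v}ᶜ) (hv : v ∉ T)
    (hP : CondP G T) : HasAcyclicTOddOrientation G T := by
  obtain ⟨r, hr⟩ := h.ranked
  rw [Set.compl_eq_univ_sdiff] at hr
  exact (Ranked.insert_first (Set.mem_univ v) hv (hr _)).hasAcyclicTOddOrientation hP

theorem Good.hasAcyclicTOddOrientation_of_pair {u v : V} (h : Good G {v, u}ᶜ) (huv : u ≠ v)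
    (hv : v ∉ T) (hu : u ∈ T ↔ G.Adj v u) (hP : CondP G T) : HasAcyclicTOddOrientation G T := by
  obtain ⟨r, hr⟩ := h.ranked
  have : ({v, u}ᶜ : Set V) = (Set.univ \ {v}) \ {u} := by
    ext x
    simp
  rw [this] at hr
  refine (Ranked.insert_first (Set.mem_univ v) hv
    (Ranked.insert_first ⟨Set.mem_univ u, huv⟩ ?_ (hr _))).hasAcyclicTOddOrientation hP
  simp [Set.mem_symmDiff, nbrsIn, hu]

end FirstVertices

section CylinderCases

variable {p q : ℕ} {ψ : Fin q → ℕ}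

theorem good_cylinder_univ (hp : 3 ≤ p) (hq : 1 ≤ q) (hp' : Odd p) (hq' : Even q) :
    Good (cycleGraph p □ pathGraph q) Set.univ := by
  obtain ⟨k, hk⟩ := hp'
  obtain ⟨n, hn⟩ := hq'
  refine TGood.boxProd (TGood.cylinder (q := q + 2) (c := 0) (k := k - 1) (n := n - 1)
    ?_ ?_ ?_ ?_) (cycEmb_cycleGraph hp) cycEmb_pathGraph ?_ ?_
  rotate_right
  · intro x
    simp
    omega
  all_goals omega

theorem good_cylinder_compl_singleton (hp : 3 ≤ p) (hpq : Odd p → Odd q) (v : Fin p × Fin q)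
    (hv : q = 1 ∨ (0 < v.2.val ∧ v.2.val + 1 < q)) :
    Good (cycleGraph p □ pathGraph q) {v}ᶜ := by
  obtain ⟨φ, hφ, h0⟩ := exists_cycEmb hp v.1
  have key : ∀ x : Fin p × Fin q, x = v ↔ φ x.1 = 0 ∧ x.2.val = v.2.val := by
    intro x
    rw [← h0, hφ.inj.eq_iff, Prod.ext_iff, ← Fin.ext_iff]
  rcases hv with hv | ⟨hv, hv'⟩
  · refine TGood.boxProd (TGood.grid (q := q + 2) (a := 1) (b := p) (c := 0) (n := 0) hp
      ?_ ?_ ?_ ?_ ?_ ?_) hφ cycEmb_pathGraph ?_ ?_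
    rotate_right
    · intro x
      rw [Set.mem_compl_iff, Set.mem_singleton_iff, key]
      have := hφ.lt x.1
      omega
    all_goals omega
  · rcases Nat.even_or_odd q with hq | hq
    · have hp' : Even p := by
        by_contra h
        exact Nat.not_even_iff_odd.2 (hpq (Nat.not_even_iff_odd.1 h)) hq
      obtain ⟨k, hk⟩ := hp'
      obtain ⟨n, hn⟩ := hq
      refine TGood.boxProd (TGood.cylinder_sdiff_inner_even (q := q + 2) (c := 0) (k := k - 2)
        (n := n - 2) (m := v.2.val) ?_ ?_ ?_ ?_ ?_ ?_) hφ cycEmb_pathGraph ?_ ?_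
      rotate_right
      · intro x
        rw [Set.mem_compl_iff, Set.mem_singleton_iff, key]
        have := hφ.lt x.1
        omega
      all_goals omega
    · obtain ⟨n, hn⟩ := hq
      refine TGood.boxProd (TGood.cylinder_sdiff_inner (q := q + 2) (c := 0)
        (n := n - 1) (m := v.2.val) hp ?_ ?_ ?_ ?_ ?_) hφ cycEmb_pathGraph ?_ ?_
      rotate_right
      · intro x
        rw [Set.mem_compl_iff, Set.mem_singleton_iff, key]
        have := hφ.lt x.1
        omega
      all_goals omega

theorem good_cylinder_compl_pair (hp : 3 ≤ p) (hq : 2 ≤ q) (hpq : Odd p → Odd q)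
    (hψ : CycEmb (pathGraph q) (q + 2) ψ) {i i' : Fin p} (h : (cycleGraph p).Adj i i') {j : Fin q}
    (hj : ψ j = 0) : Good (cycleGraph p □ pathGraph q) {(i, j), (i', j)}ᶜ := by
  obtain ⟨φ, hφ, h0, h1⟩ := exists_cycEmb_of_adj hp h
  have key : ∀ x : Fin p × Fin q, x ∈ ({(i, j), (i', j)} : Set (Fin p × Fin q)) ↔
      φ x.1 ≤ 1 ∧ ψ x.2 = 0 := by
    rintro ⟨x, y⟩
    simp only [Set.mem_insert_iff, Set.mem_singleton_iff, Prod.mk.injEq, ← hφ.inj.eq_iff,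
      ← hψ.inj.eq_iff, h0, h1, hj]
    omega
  rcases Nat.even_or_odd q with hq | hq
  · have hp' : Even p := by
      by_contra h
      exact Nat.not_even_iff_odd.2 (hpq (Nat.not_even_iff_odd.1 h)) hq
    obtain ⟨k, hk⟩ := hp'
    obtain ⟨n, hn⟩ := hq
    refine TGood.boxProd (TGood.cylinder_sdiff_pair_even (q := q + 2) (c := 0) (k := k - 2)
      (n := n - 1) ?_ ?_ ?_ ?_) hφ hψ ?_ ?_
    rotate_right
    · intro x
      rw [Set.mem_compl_iff, key]
      have := hφ.lt x.1
      have := hψ.lt x.2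
      omega
    all_goals omega
  · obtain ⟨n, hn⟩ := hq
    refine TGood.boxProd (TGood.cylinder_sdiff_pair (q := q + 2) (c := 0)
      (n := n - 1) hp ?_ ?_ ?_) hφ hψ ?_ ?_
    rotate_right
    · intro x
      rw [Set.mem_compl_iff, key]
      have := hφ.lt x.1
      have := hψ.lt x.2
      omega
    all_goals omega

theorem mul_add_lt_mul_add_iff {p a b x y : ℕ} (hx : x < p) (hy : y < p) :
    a * p + x < b * p + y ↔ a < b ∨ a = b ∧ x < y := by
  rcases lt_trichotomy a b with h | rfl | h
  · have := Nat.mul_le_mul_right p h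
    rw [Nat.succ_mul] at this
    simp only [h, true_or, iff_true]
    omega
  · simp
  · have := Nat.mul_le_mul_right p h
    rw [Nat.succ_mul] at this
    omega

/-- If `p` is even and `T` is the complement of an extremal row of a cylinder over `C_p`, one can
orient the rows alternatingly and the columns away from that row. -/
theorem ranked_compl_row (hp : 3 ≤ p) (hp' : Even p) (hq : 1 ≤ q)
    (hψ : CycEmb (pathGraph q) (q + 2) ψ) {T : Set (Fin p × Fin q)}
    (hT : ∀ i j, (i, j) ∈ T ↔ ψ j ≠ 0) (E : Set (Fin p × Fin q)) :
    Ranked (cycleGraph p □ pathGraph q) E Set.univ T := by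
  have hφ := cycEmb_cycleGraph hp
  set R : ℕ × ℕ → ℕ := fun x => (2 * x.2 + x.1 % 2) * p + x.1 with hR
  have hlt : ∀ x y : ℕ × ℕ, x.1 < p → y.1 < p → (R x < R y ↔
      (2 * x.2 + x.1 % 2 < 2 * y.2 + y.1 % 2 ∨ 2 * x.2 + x.1 % 2 = 2 * y.2 + y.1 % 2 ∧
        x.1 < y.1)) := fun x y hx hy => mul_add_lt_mul_add_iff hx hy
  refine ⟨fun x => R (Prod.map Fin.val ψ x), ?_, ?_⟩
  · rintro ⟨i, j⟩ - ⟨i', j'⟩ - h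
    have h1 := hlt (i.val, ψ j) (i'.val, ψ j') i.isLt i'.isLt
    have h2 := hlt (i'.val, ψ j') (i.val, ψ j) i'.isLt i.isLt
    simp only [Prod.map] at h
    rw [h] at h1 h2
    simp only [lt_irrefl, false_iff] at h1 h2
    have h3 : ψ j = ψ j' := by omega
    have h4 : i.val = i'.val := by omega
    rw [hψ.inj h3, Fin.ext h4]
  · rintro ⟨i, j⟩ - -
    have hj := hψ.lt j
    have hcard : {w | w ∈ Set.univ ∧ (cycleGraph p □ pathGraph q).Adj (i, j) w ∧
        R (Prod.map Fin.val ψ w) < R (Prod.map Fin.val ψ (i, j))}.ncard =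
        {w | w ∈ {x : ℕ × ℕ | x.1 < p ∧ x.2 < q ∧ R x < R (i.val, ψ j)} ∧
          (torusGraph p (q + 2)).Adj (i.val, ψ j) w}.ncard := by
      rw [← Set.ncard_image_of_injective _ (hφ.inj.prodMap hψ.inj)]
      congr 1
      ext ⟨x, y⟩
      constructor
      · rintro ⟨⟨a, b⟩, ⟨-, h1, h2⟩, he⟩
        rw [← he]
        refine ⟨⟨a.isLt, hψ.lt b, h2⟩, ?_⟩
        simpa [torusGraph, boxProd_adj, hφ.adj, hψ.adj, Fin.ext_iff, hψ.inj.eq_iff, or_comm,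
          and_comm] using h1
      · rintro ⟨⟨h1, h2, h3⟩, h4⟩
        obtain ⟨a, rfl⟩ := hφ.surj x h1
        obtain ⟨b, rfl⟩ := hψ.surj y h2
        refine ⟨(a, b), ⟨trivial, ?_, h3⟩, rfl⟩
        simpa [torusGraph, boxProd_adj, hφ.adj, hψ.adj, Fin.ext_iff, hψ.inj.eq_iff, or_comm,
          and_comm] using h4
    rw [hcard, odd_ncard_torus hp (by omega) i.isLt (by omega), hT]
    have hi := i.isLt
    obtain ⟨k, hk⟩ := hp'
    have hs : cycSucc p i.val < p := by grind
    have hr : cycPred p i.val < p := by grind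
    have h1 : (cycSucc p i.val, ψ j) ∈ {x : ℕ × ℕ | x.1 < p ∧ x.2 < q ∧ R x < R (i.val, ψ j)} ↔
        i.val % 2 = 1 := by
      simp only [Set.mem_ofPred_eq, hs, hj, true_and]
      grind
    have h2 : (cycPred p i.val, ψ j) ∈ {x : ℕ × ℕ | x.1 < p ∧ x.2 < q ∧ R x < R (i.val, ψ j)} ↔
        i.val % 2 = 1 := by
      simp only [Set.mem_ofPred_eq, hr, hj, true_and]
      grind
    have h3 : (i.val, cycSucc (q + 2) (ψ j)) ∉
        {x : ℕ × ℕ | x.1 < p ∧ x.2 < q ∧ R x < R (i.val, ψ j)} := by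
      simp only [Set.mem_ofPred_eq, hlt (_, _) (_, _) hi hi]
      grind
    have h4 : (i.val, cycPred (q + 2) (ψ j)) ∈
        {x : ℕ × ℕ | x.1 < p ∧ x.2 < q ∧ R x < R (i.val, ψ j)} ↔ ψ j ≠ 0 := by
      simp only [Set.mem_ofPred_eq, hlt (_, _) (_, _) hi hi]
      grind
    rw [h1, h2, h4]
    simp only [h3, true_iff, false_iff, not_not]

end CylinderCases

section Main

variable {p q : ℕ}

theorem cylinder_of_row_const (hp : 3 ≤ p) (hq : 2 ≤ q) (hpq : Odd p → Odd q) {ψ : Fin q → ℕ}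
    (hψ : CycEmb (pathGraph q) (q + 2) ψ) {T : Set (Fin p × Fin q)}
    (hT : ∀ i j, (i, j) ∈ T ↔ ψ j ≠ 0) (hP : CondP (cycleGraph p □ pathGraph q) T) :
    HasAcyclicTOddOrientation (cycleGraph p □ pathGraph q) T := by
  rcases Nat.even_or_odd p with hp' | hp'
  · exact (ranked_compl_row (E := {(⟨0, by omega⟩, ⟨0, by omega⟩)}) hp hp' (by omega)
      hψ hT).hasAcyclicTOddOrientation hP
  · exfalso
    obtain ⟨j₀, hj₀⟩ := hψ.surj 0 (by omega)
    have hT' : T = Set.univ ×ˢ {j₀}ᶜ := by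
      ext ⟨i, j⟩
      rw [hT, ← hj₀, hψ.inj.ne_iff]
      simp
    have hc : T.ncard = p * (q - 1) := by
      rw [hT', Set.ncard_prod, Set.ncard_compl]
      simp
    obtain ⟨l, rfl⟩ : ∃ l, q = l + 1 := ⟨q - 1, by omega⟩
    rw [CondP, edgeSet_ncard_cylinder hp, hc, Nat.add_sub_cancel] at hP
    have hl : Even l := by
      have := hpq hp'
      rw [Nat.odd_add_one, Nat.not_odd_iff_even] at this
      exact this
    rw [Nat.even_add, Nat.even_mul, Nat.even_mul] at hP
    have h1 : ¬ Even p := Nat.not_even_iff_odd.2 hp'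
    have h2 : ¬ Even (2 * l + 1) := by simp
    tauto

theorem cylinder_hasAcyclicTOddOrientation (hp : 3 ≤ p) (hq : 1 ≤ q) (T : Set (Fin p × Fin q))
    (hP : CondP (cycleGraph p □ pathGraph q) T) (hS : CondS (cycleGraph p □ pathGraph q) T)
    (hS' : CondSbar (cycleGraph p □ pathGraph q) T) :
    HasAcyclicTOddOrientation (cycleGraph p □ pathGraph q) T := by
  by_cases hpq : Odd p ∧ Even q
  · exact (good_cylinder_univ hp hq hpq.1 hpq.2).hasAcyclicTOddOrientation hP
  replace hpq : Odd p → Odd q := fun h => by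
    by_contra h'
    exact hpq ⟨h, Nat.not_odd_iff_even.1 h'⟩
  by_contra hno
  have inner : ∀ v : Fin p × Fin q, (q = 1 ∨ (0 < v.2.val ∧ v.2.val + 1 < q)) → v ∈ T := by
    intro v hv
    by_contra hvT
    exact hno ((good_cylinder_compl_singleton hp hpq v hv).hasAcyclicTOddOrientation_of_notMem
      hvT hP)
  have hq2 : 2 ≤ q := by
    by_contra h
    obtain ⟨v, hv⟩ := hS.1
    exact hv (inner v (Or.inl (by omega)))
  have row : ∀ ψ, CycEmb (pathGraph q) (q + 2) ψ → ∀ j, ψ j = 0 → ∀ i i',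
      (cycleGraph p).Adj i i' → (i, j) ∉ T → (i', j) ∉ T := by
    intro ψ hψ j hj i i' h hi hi'
    refine hno ((good_cylinder_compl_pair hp hq2 hpq hψ h hj).hasAcyclicTOddOrientation_of_pair
      ?_ hi ?_ hP)
    · simpa using h.ne'
    · simp [hi', boxProd_adj, h]
  have row' : ∀ ψ, CycEmb (pathGraph q) (q + 2) ψ → ∀ j, ψ j = 0 → ∀ i i',
      (i, j) ∈ T → (i', j) ∈ T := by
    intro ψ hψ j hj
    have h0 : ∀ k (hk : k < p), (⟨k, hk⟩, j) ∈ T ↔ (⟨0, by omega⟩, j) ∈ T := by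
      intro k
      induction k with
      | zero => exact fun _ => Iff.rfl
      | succ k ih =>
        intro hk
        rw [← ih (by omega)]
        have hadj : (cycleGraph p).Adj ⟨k, by omega⟩ ⟨k + 1, hk⟩ := by
          rw [(cycEmb_cycleGraph hp).adj]
          exact ⟨by omega, hk, k.succ_ne_self.symm, Or.inl rfl⟩
        have h1 := row ψ hψ j hj _ _ hadj
        have h2 := row ψ hψ j hj _ _ hadj.symm
        tauto
    intro i i'
    rw [h0 i.val i.isLt, h0 i'.val i'.isLt]
    exact id
  set i₀ : Fin p := ⟨0, by omega⟩
  set a : Fin q := ⟨0, by omega⟩ with ha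
  set b : Fin q := ⟨q - 1, by omega⟩ with hb
  have hrev : q - 1 - b.val = 0 := by simp [hb]
  have rowa := row' _ cycEmb_pathGraph a rfl
  have rowb := row' _ cycEmb_pathGraph_rev b hrev
  have cases_row : ∀ j : Fin q, j = a ∨ j = b ∨ (0 < j.val ∧ j.val + 1 < q) := by
    intro j
    simp only [ha, hb, Fin.ext_iff]
    omega
  by_cases hTa : (i₀, a) ∈ T <;> by_cases hTb : (i₀, b) ∈ T
  · obtain ⟨⟨i, j⟩, hv⟩ := hS.1
    refine hv ?_
    rcases cases_row j with rfl | rfl | hj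
    · exact rowa _ _ hTa
    · exact rowb _ _ hTb
    · exact inner _ (Or.inr hj)
  · refine hno (cylinder_of_row_const hp hq2 hpq cycEmb_pathGraph_rev (fun i j => ?_) hP)
    rcases cases_row j with rfl | rfl | hj
    · exact iff_of_true (rowa _ _ hTa) (by simp [ha]; omega)
    · exact iff_of_false (fun h => hTb (rowb _ _ h)) (by simp [hrev])
    · exact iff_of_true (inner _ (Or.inr hj)) (by omega)
  · refine hno (cylinder_of_row_const hp hq2 hpq cycEmb_pathGraph (fun i j => ?_) hP)
    rcases cases_row j with rfl | rfl | hj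
    · exact iff_of_false (fun h => hTa (rowa _ _ h)) (by simp [ha])
    · exact iff_of_true (rowb _ _ hTb) (by simp [hb]; omega)
    · exact iff_of_true (inner _ (Or.inr hj)) (by omega)
  · obtain ⟨⟨i, j⟩, hv⟩ := hS'.1
    simp only [sinkSet, Set.mem_ofPred_eq, vdeg_boxProd, vdeg_cycleGraph hp, vdeg_pathGraph] at hv
    rcases cases_row j with rfl | rfl | hj
    · have h1 : (i, a) ∉ T := fun h => hTa (rowa _ _ h)
      have h2 : ¬ 0 + 1 = q := by omega
      obtain ⟨h, -⟩ | ⟨-, h⟩ := hv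
      · exact h1 h
      · simp only [ha, if_true, if_neg h2] at h
        exact absurd h (by decide)
    · have h1 : (i, b) ∉ T := fun h => hTb (rowb _ _ h)
      have h2 : ¬ q - 1 = 0 := by omega
      have h3 : q - 1 + 1 = q := by omega
      obtain ⟨h, -⟩ | ⟨-, h⟩ := hv
      · exact h1 h
      · simp only [hb, h3, if_true, if_neg h2] at h
        exact absurd h (by decide)
    · have h1 : (i, j) ∈ T := inner _ (Or.inr hj)
      simp [h1, hj.1.ne', hj.2.ne] at hv
      exact absurd hv (by decide)

theorem good_torus_compl_singleton (hp : 4 ≤ p) (hq : 4 ≤ q) (hpq : Even p ∨ Even q)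
    (v : Fin p × Fin q) : Good (cycleGraph p □ cycleGraph q) {v}ᶜ := by
  obtain ⟨φ, hφ, h1⟩ := exists_cycEmb (by omega) v.1
  obtain ⟨ψ, hψ, h2⟩ := exists_cycEmb (by omega) v.2
  have key : ∀ x : Fin p × Fin q, x = v ↔ φ x.1 = 0 ∧ ψ x.2 = 0 := by
    intro x
    rw [Prod.ext_iff, ← hφ.inj.eq_iff, ← hψ.inj.eq_iff, h1, h2]
  have main : TGood p q fun x y => x < p ∧ y < q ∧ ¬ (x = 0 ∧ y = 0) := by
    rcases hpq with ⟨k, hk⟩ | ⟨k, hk⟩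
    · exact TGood.torus_sdiff (k := k - 2) (by omega) (by omega)
    · exact (TGood.torus_sdiff (k := k - 2) (by omega) (by omega)).swap.congr fun x y => by omega
  refine main.boxProd hφ hψ (fun x y h => ⟨h.1, h.2.1⟩) fun x => ?_
  rw [Set.mem_compl_iff, Set.mem_singleton_iff, key]
  simp [hφ.lt, hψ.lt]

theorem good_torus_compl_pair (hp : 5 ≤ p) (hq : 5 ≤ q) (hp' : Odd p) (hq' : Odd q)
    {u v : Fin p × Fin q} (huv : v ≠ u) (h : ¬ (cycleGraph p □ cycleGraph q).Adj v u) :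
    Good (cycleGraph p □ cycleGraph q) {v, u}ᶜ := by
  obtain ⟨k, hk⟩ := hp'
  obtain ⟨l, hl⟩ := hq'
  have key : ∀ φ ψ, CycEmb (cycleGraph p) p φ → CycEmb (cycleGraph q) q ψ →
      ∀ x : Fin p × Fin q, x ∈ ({v, u}ᶜ : Set (Fin p × Fin q)) ↔
        φ x.1 < p ∧ ψ x.2 < q ∧ ¬ (φ x.1 = φ v.1 ∧ ψ x.2 = ψ v.2) ∧
          ¬ (φ x.1 = φ u.1 ∧ ψ x.2 = ψ u.2) := by
    intro φ ψ hφ hψ x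
    simp [hφ.lt, hψ.lt, hφ.inj.eq_iff, hψ.inj.eq_iff, Prod.ext_iff]
  by_cases h1 : v.1 ≠ u.1 ∧ ¬ (cycleGraph p).Adj v.1 u.1
  · obtain ⟨φ, hφ, hv, hu, hu'⟩ := exists_cycEmb_of_not_adj hp h1.1 h1.2
    obtain ⟨ψ, hψ, hv2⟩ := exists_cycEmb (by omega) v.2
    refine (TGood.torus_sdiff_far (k := k - 2) (l := l - 1) (by omega) (by omega) hu hu'
      (hψ.lt u.2)).boxProd hφ hψ (fun x y h => ⟨h.1, h.2.1⟩) fun x => ?_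
    rw [key φ ψ hφ hψ, hv, hv2]
  by_cases h2 : v.2 ≠ u.2 ∧ ¬ (cycleGraph q).Adj v.2 u.2
  · obtain ⟨φ, hφ, hv, hu, hu'⟩ := exists_cycEmb_of_not_adj hq h2.1 h2.2
    obtain ⟨ψ, hψ, hv2⟩ := exists_cycEmb (by omega) v.1
    refine (TGood.torus_sdiff_far (k := l - 2) (l := k - 1) (by omega) (by omega) hu hu'
      (hψ.lt u.1)).swap.boxProd hψ hφ (fun x y h => ⟨h.2.1, h.1⟩) fun x => ?_
    rw [key ψ φ hψ hφ, hv, hv2]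
    tauto
  have h3 : (cycleGraph p).Adj v.1 u.1 ∧ (cycleGraph q).Adj u.2 v.2 := by
    rw [boxProd_adj] at h
    rw [ne_eq, Prod.ext_iff] at huv
    rw [(cycleGraph q).adj_comm]
    tauto
  obtain ⟨φ, hφ, hv, hu⟩ := exists_cycEmb_of_adj (by omega) h3.1
  obtain ⟨ψ, hψ, hu2, hv2⟩ := exists_cycEmb_of_adj (by omega) h3.2
  refine (TGood.torus_sdiff_diagonal (k := k - 1) (l := l - 1) (by omega) (by omega)).boxProd
    hφ hψ.reflect (fun x y h => ⟨h.1, h.2.1⟩) fun x => ?_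
  rw [key φ _ hφ hψ.reflect, hu, hu2, hv, hv2]
  simp only [if_true, one_ne_zero, if_false]
  tauto

theorem torus_hasAcyclicTOddOrientation (hp : 4 ≤ p) (hq : 4 ≤ q) (T : Set (Fin p × Fin q))
    (hP : CondP (cycleGraph p □ cycleGraph q) T) (hS : CondS (cycleGraph p □ cycleGraph q) T) :
    HasAcyclicTOddOrientation (cycleGraph p □ cycleGraph q) T := by
  by_cases hpq : Even p ∨ Even q
  · obtain ⟨v, hv⟩ := hS.1
    exact (good_torus_compl_singleton hp hq hpq v).hasAcyclicTOddOrientation_of_notMem hv hP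
  simp only [not_or, Nat.not_even_iff_odd] at hpq
  have hcard : T.ncard + Tᶜ.ncard = p * q := by
    rw [Set.ncard_add_ncard_compl]
    simp
  have hodd : Odd Tᶜ.ncard := by
    rw [CondP, edgeSet_ncard_torus (by omega) (by omega), Nat.even_add] at hP
    have hT : Even T.ncard := hP.1 (even_two_mul _)
    have := hpq.1.mul hpq.2
    rw [← hcard, Nat.odd_add'] at this
    exact this.2 hT
  have hsink : sinkSet (cycleGraph p □ cycleGraph q) T = sourceSet T := by
    ext v
    simp only [sinkSet, sourceSet, Set.mem_ofPred_eq, vdeg_boxProd,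
      vdeg_cycleGraph (show 3 ≤ p by omega), vdeg_cycleGraph (show 3 ≤ q by omega)]
    have : Even (2 + 2) := by decide
    have : ¬ Odd (2 + 2) := by decide
    simp [*]
  have hne : Tᶜ.ncard ≠ 1 := by
    intro h1
    rcases hS.2 h1 with h | h
    · rw [Nat.card_prod, Nat.card_fin, Nat.card_fin] at h
      have := Nat.mul_le_mul hp hq
      omega
    · exact h hsink.symm
  have h2 : 2 < Tᶜ.ncard := by
    obtain ⟨n, hn⟩ := hodd
    omega
  obtain ⟨a, b, c, ha, hb, hc, hab, hac, hbc⟩ := (Set.two_lt_ncard_iff (Set.toFinite _)).1 h2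
  have hp5 : 5 ≤ p := by
    obtain ⟨n, hn⟩ := hpq.1
    omega
  have hq5 : 5 ≤ q := by
    obtain ⟨n, hn⟩ := hpq.2
    omega
  have finish : ∀ v u, v ∉ T → u ∉ T → v ≠ u → ¬ (cycleGraph p □ cycleGraph q).Adj v u →
      HasAcyclicTOddOrientation (cycleGraph p □ cycleGraph q) T := fun v u hv hu huv h =>
    (good_torus_compl_pair hp5 hq5 hpq.1 hpq.2 huv h).hasAcyclicTOddOrientation_of_pair huv.symm hv
      (iff_of_false hu h) hP
  by_cases h1 : (cycleGraph p □ cycleGraph q).Adj a b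
  swap
  · exact finish a b ha hb hab h1
  by_cases h2 : (cycleGraph p □ cycleGraph q).Adj a c
  swap
  · exact finish a c ha hc hac h2
  refine finish b c hb hc hbc fun h3 => ?_
  have hφ := cycEmb_cycleGraph (show 3 ≤ p by omega)
  have hψ := cycEmb_cycleGraph (show 3 ≤ q by omega)
  simp only [boxProd_adj, hφ.adj, hψ.adj, cycAdj, Fin.ext_iff] at h1 h2 h3
  omega

end Main

/-- Theorem 2: cylinders `C_p □ P_q` (and tori `C_p □ C_q` with `p, q ≥ 4`)
admit acyclic `T`-odd orientations for every `T` satisfying `𝒫`, `𝒮` and `𝒮̄`. -/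
theorem cylinder_torus_carac (p q : ℕ) (hp : 3 ≤ p) (hq : 1 ≤ q) :
    (∀ T : Set (Fin p × Fin q),
        CondP (cycleGraph p □ pathGraph q) T →
        CondS (cycleGraph p □ pathGraph q) T →
        CondSbar (cycleGraph p □ pathGraph q) T →
        HasAcyclicTOddOrientation (cycleGraph p □ pathGraph q) T) ∧
    (3 ≤ q → 4 ≤ p → 4 ≤ q →
      ∀ T : Set (Fin p × Fin q),
        CondP (cycleGraph p □ cycleGraph q) T →
        CondS (cycleGraph p □ cycleGraph q) T →
        CondSbar (cycleGraph p □ cycleGraph q) T →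
        HasAcyclicTOddOrientation (cycleGraph p □ cycleGraph q) T) := by
  exact ⟨fun T hP hS hS' => cylinder_hasAcyclicTOddOrientation hp hq T hP hS hS',
    fun _ hp' hq' T hP hS _ => torus_hasAcyclicTOddOrientation hp' hq' T hP hS⟩
end
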